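/- arXiv:1909.05474 — 5 statements merged into one kernel-verified Lean document; each statement's English description precedes it below -/
import Mathlib

section
/- Let κ be an infinite cardinal and λ ≥ κ a cardinal. If κ is λ-square compact and X and Y are Hausdorff (<κ)-compact topological spaces each of weight at most λ, then the product space X × Y is (<κ)-compact. -/
universe u v

open Cardinal TopologicalSpace

/-- A topological space is `(<κ)`-compact if every open cover has a subcover of
cardinality strictly less than `κ`. -/
def KappaCompactSpace (κ : Cardinal.{u}) (X : Type u) [TopologicalSpace X] : Prop :=
  ∀ 𝒰 : Set (Set X), (∀ U ∈ 𝒰, IsOpen U) → ⋃₀ 𝒰 = Set.univ →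
    ∃ 𝒱 ⊆ 𝒰, #𝒱 < κ ∧ ⋃₀ 𝒱 = Set.univ

/-- `w(X) ≤ λ` : the space `X` has a base for its topology of cardinality at most `λ`. -/
def WeightLE (X : Type u) [TopologicalSpace X] (lam : Cardinal.{u}) : Prop :=
  ∃ B : Set (Set X), IsTopologicalBasis B ∧ #B ≤ lam

/-- `κ` is `λ`-square compact: for every Hausdorff `(<κ)`-compact space `X` of weight
at most `λ`, the square `X × X` is `(<κ)`-compact. -/
def SquareCompact (κ lam : Cardinal.{u}) : Prop :=
  ∀ (X : Type u) [TopologicalSpace X], T2Space X →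
    KappaCompactSpace κ X → WeightLE X lam → KappaCompactSpace κ (X × X)

theorem KappaCompactSpace.exists_subset_range_subset {κ : Cardinal.{u}} {X Z : Type u}
    [TopologicalSpace X] [TopologicalSpace Z] (hX : KappaCompactSpace κ X) {f : X → Z}
    (hf : Continuous f) {𝒰 : Set (Set Z)} (ho : ∀ U ∈ 𝒰, IsOpen U)
    (hc : Set.range f ⊆ ⋃₀ 𝒰) : ∃ 𝒱 ⊆ 𝒰, #𝒱 < κ ∧ Set.range f ⊆ ⋃₀ 𝒱 := by
  obtain ⟨𝒲, h𝒲, hcard, hcov⟩ := hX ((f ⁻¹' ·) '' 𝒰)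
    (by rintro _ ⟨U, hU, rfl⟩; exact (ho U hU).preimage hf)
    (by
      refine Set.eq_univ_of_forall fun x => ?_
      obtain ⟨U, hU, hxU⟩ := hc ⟨x, rfl⟩
      exact ⟨_, ⟨U, hU, rfl⟩, hxU⟩)
  have h𝒲' : ∀ W ∈ 𝒲, ∃ U ∈ 𝒰, f ⁻¹' U = W := fun W hW => h𝒲 hW
  choose! g hg hgf using h𝒲'
  refine ⟨g '' 𝒲, by rintro _ ⟨W, hW, rfl⟩; exact hg W hW, mk_image_le.trans_lt hcard, ?_⟩
  rintro _ ⟨x, rfl⟩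
  obtain ⟨W, hW, hxW⟩ : x ∈ ⋃₀ 𝒲 := hcov ▸ Set.mem_univ x
  refine ⟨g W, ⟨W, hW, rfl⟩, ?_⟩
  rw [← hgf W hW] at hxW
  exact hxW

theorem KappaCompactSpace.sum {κ : Cardinal.{u}} (hκ : ℵ₀ ≤ κ) {X Y : Type u}
    [TopologicalSpace X] [TopologicalSpace Y] (hX : KappaCompactSpace κ X)
    (hY : KappaCompactSpace κ Y) : KappaCompactSpace κ (X ⊕ Y) := by
  intro 𝒰 ho hc
  obtain ⟨𝒱, h𝒱, h𝒱card, h𝒱cov⟩ :=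
    hX.exists_subset_range_subset continuous_inl ho (hc ▸ Set.subset_univ _)
  obtain ⟨𝒲, h𝒲, h𝒲card, h𝒲cov⟩ :=
    hY.exists_subset_range_subset continuous_inr ho (hc ▸ Set.subset_univ _)
  refine ⟨𝒱 ∪ 𝒲, Set.union_subset h𝒱 h𝒲,
    (mk_union_le _ _).trans_lt (add_lt_of_lt hκ h𝒱card h𝒲card), ?_⟩
  rw [Set.sUnion_union, Set.eq_univ_iff_forall]
  rintro (x | y)
  · exact Or.inl (h𝒱cov ⟨x, rfl⟩)
  · exact Or.inr (h𝒲cov ⟨y, rfl⟩)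

theorem KappaCompactSpace.of_isClosedEmbedding {κ : Cardinal.{u}} {X Z : Type u}
    [TopologicalSpace X] [TopologicalSpace Z] (hZ : KappaCompactSpace κ Z) {f : X → Z}
    (hf : Topology.IsClosedEmbedding f) : KappaCompactSpace κ X := by
  intro 𝒰 ho hc
  obtain ⟨𝒲, h𝒲, hcard, hcov⟩ := hZ {W | IsOpen W ∧ ((Set.range f ∩ W).Nonempty → f ⁻¹' W ∈ 𝒰)}
    (fun _ hW => hW.1)
    (by
      refine Set.eq_univ_of_forall fun z => ?_
      by_cases hz : z ∈ Set.range f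
      · obtain ⟨x, rfl⟩ := hz
        obtain ⟨U, hU, hxU⟩ : x ∈ ⋃₀ 𝒰 := hc ▸ Set.mem_univ x
        obtain ⟨W, hW, rfl⟩ := hf.isOpen_iff.1 (ho U hU)
        exact ⟨W, ⟨hW, fun _ => hU⟩, hxU⟩
      · exact ⟨(Set.range f)ᶜ, ⟨hf.isClosed_range.isOpen_compl,
          fun ⟨_, hy, hy'⟩ => absurd hy hy'⟩, hz⟩)
  refine ⟨((f ⁻¹' ·) '' 𝒲) ∩ 𝒰, Set.inter_subset_right,
    ((mk_le_mk_of_subset Set.inter_subset_left).trans mk_image_le).trans_lt hcard,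
    Set.eq_univ_of_forall fun x => ?_⟩
  obtain ⟨W, hW, hxW⟩ : f x ∈ ⋃₀ 𝒲 := hcov ▸ Set.mem_univ (f x)
  exact ⟨f ⁻¹' W, ⟨⟨W, hW, rfl⟩, (h𝒲 hW).2 ⟨f x, ⟨x, rfl⟩, hxW⟩⟩, hxW⟩

theorem WeightLE.sum {lam : Cardinal.{u}} (hlam : ℵ₀ ≤ lam) {X Y : Type u}
    [TopologicalSpace X] [TopologicalSpace Y] (hX : WeightLE X lam) (hY : WeightLE Y lam) :
    WeightLE (X ⊕ Y) lam := by
  obtain ⟨B, hB, hBcard⟩ := hX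
  obtain ⟨C, hC, hCcard⟩ := hY
  exact ⟨_, hB.sum hC, (mk_union_le _ _).trans
    (add_le_of_le hlam (mk_image_le.trans hBcard) (mk_image_le.trans hCcard))⟩

theorem squareCompact_prod (κ lam : Cardinal.{u}) (hκ : ℵ₀ ≤ κ) (hκlam : κ ≤ lam)
    (hsq : SquareCompact κ lam) (X Y : Type u) [TopologicalSpace X] [TopologicalSpace Y]
    [T2Space X] [T2Space Y] (hX : KappaCompactSpace κ X) (hY : KappaCompactSpace κ Y)
    (hwX : WeightLE X lam) (hwY : WeightLE Y lam) :
    KappaCompactSpace κ (X × Y) := by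
  exact (hsq (X ⊕ Y) inferInstance (hX.sum hκ hY)
    (hwX.sum (hκ.trans hκlam) hwY)).of_isClosedEmbedding
    (Topology.IsClosedEmbedding.inl.prodMap Topology.IsClosedEmbedding.inr)
end

section
/- Suppose that 2^κ (the set of all functions from κ to {0,1}, where {0,1} is discrete), equipped with the (<κ)-box topology, is (<κ)-compact. Then 2^θ < κ for every cardinal θ < κ. -/
universe u v

open Cardinal TopologicalSpace

/-- The `(<κ)`-box topology on a product: generated by boxes `Π O i` of open sets
in which fewer than `κ` coordinates differ from the whole space. -/
def boxTopology (κ : Cardinal.{u}) {ι : Type u} (X : ι → Type v)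
    [∀ i, TopologicalSpace (X i)] : TopologicalSpace (∀ i, X i) :=
  TopologicalSpace.generateFrom
    {B | ∃ O : ∀ i, Set (X i), (∀ i, IsOpen (O i)) ∧ #{i | O i ≠ Set.univ} < κ ∧
         B = Set.univ.pi O}

theorem isOpen_boxTopology_preimage_comp {κ : Cardinal.{u}} {ι τ : Type u} (hτ : #τ < κ)
    (f : τ → ι) (s : τ → Bool) :
    @IsOpen _ (boxTopology κ fun _ : ι => Bool) {x : ι → Bool | x ∘ f = s} := by
  refine isOpen_generateFrom_of_mem
    ⟨fun i => {b | ∀ t, f t = i → b = s t}, fun _ => isOpen_discrete _, ?_, ?_⟩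
  · refine lt_of_le_of_lt ((mk_le_mk_of_subset ?_).trans (mk_range_le (f := f))) hτ
    intro i hi
    by_contra hmem
    exact hi (Set.eq_univ_of_forall fun b t ht => absurd ⟨t, ht⟩ hmem)
  · ext x
    simp only [Set.mem_ofPred_eq, funext_iff, Function.comp_apply, Set.mem_univ_pi]
    exact ⟨fun hx _ t ht => ht ▸ hx t, fun hx t => hx _ t rfl⟩

theorem two_pow_lt_of_box_compact (κ : Cardinal.{u}) (hκ : ℵ₀ ≤ κ)
    (h : @KappaCompactSpace κ (κ.out → Bool) (boxTopology κ fun _ : κ.out => Bool)) :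
    ∀ θ : Cardinal.{u}, θ < κ → 2 ^ θ < κ := by
  intro θ hθ
  obtain ⟨f⟩ : Nonempty (θ.out ↪ κ.out) := by
    rw [← Cardinal.le_def, mk_out, mk_out]
    exact hθ.le
  let U : (θ.out → Bool) → Set (κ.out → Bool) := fun s => {x | x ∘ f = s}
  obtain ⟨𝒱, h𝒱U, h𝒱, hcover⟩ := h (Set.range U)
    (by
      rintro _ ⟨s, rfl⟩
      exact isOpen_boxTopology_preimage_comp (by rwa [mk_out]) f s)
    (Set.eq_univ_of_forall fun x => ⟨U (x ∘ f), ⟨_, rfl⟩, rfl⟩)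
  have hsurj (s : θ.out → Bool) : ∃ x : κ.out → Bool, x ∘ f = s :=
    f.injective.surjective_comp_right s
  have hmem (s : θ.out → Bool) : U s ∈ 𝒱 := by
    obtain ⟨x, rfl⟩ := hsurj s
    obtain ⟨V, hV, hxV⟩ : x ∈ ⋃₀ 𝒱 := hcover ▸ Set.mem_univ x
    obtain ⟨t, rfl⟩ := h𝒱U hV
    have hxt : x ∘ f = t := hxV
    rwa [hxt]
  have hinj : Function.Injective fun s => (⟨U s, hmem s⟩ : 𝒱) := by
    intro s t hst
    obtain ⟨x, rfl⟩ := hsurj s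
    have hx : x ∈ U (x ∘ f) := rfl
    rw [Subtype.mk.inj hst] at hx
    exact hx
  calc 2 ^ θ = #(θ.out → Bool) := by simp
    _ ≤ #𝒱 := mk_le_of_injective hinj
    _ < κ := h𝒱
end

section
/- If κ is a weakly compact cardinal, then 2^κ (the set of all functions from κ to {0,1}, with {0,1} discrete), equipped with the (<κ)-box topology, is (<κ)-compact. -/
universe u v

open Cardinal TopologicalSpace

/-- The level of a node of a tree: the order type of its set of predecessors. -/
noncomputable def treeLevel {T : Type u} [PartialOrder T]
    (h : ∀ t : T, IsWellOrder {s : T // s < t} (fun a b => (a : T) < (b : T)))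
    (t : T) : Ordinal.{u} :=
  @Ordinal.type {s : T // s < t} (fun a b => (a : T) < (b : T)) (h t)

/-- `κ` has the tree property: every tree of height `κ` all of whose levels have
cardinality `< κ` has a branch (chain) of cardinality `κ`. -/
def TreeProperty (κ : Cardinal.{u}) : Prop :=
  ∀ (T : Type u) [PartialOrder T]
    (h : ∀ t : T, IsWellOrder {s : T // s < t} (fun a b => (a : T) < (b : T))),
    (∀ t : T, treeLevel h t < κ.ord) →
    (∀ β : Ordinal.{u}, β < κ.ord → ∃ t : T, treeLevel h t = β) →
    (∀ β : Ordinal.{u}, #{t : T | treeLevel h t = β} < κ) →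
    ∃ B : Set T, IsChain (· ≤ ·) B ∧ #B = κ

/-- `κ` is weakly compact: strongly inaccessible with the tree property. -/
def WeaklyCompactCard (κ : Cardinal.{u}) : Prop :=
  κ.IsInaccessible ∧ TreeProperty κ

open scoped Topology in
/-- A point of a `(<κ)`-box open set is surrounded by all points which agree with it on some set
of fewer than `κ` coordinates. -/
theorem exists_agree_subset_of_isOpen_boxTopology {κ : Cardinal.{u}} (hκ : ℵ₀ ≤ κ) {ι : Type u}
    {X : ι → Type v} [∀ i, TopologicalSpace (X i)] {U : Set (∀ i, X i)}
    (hU : IsOpen[boxTopology κ X] U) {f : ∀ i, X i} (hf : f ∈ U) :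
    ∃ S : Set ι, #S < κ ∧ ∀ g : ∀ i, X i, (∀ i ∈ S, g i = f i) → g ∈ U := by
  induction hU with
  | basic B hB =>
    obtain ⟨O, -, hO, rfl⟩ := hB
    refine ⟨{i | O i ≠ Set.univ}, hO, fun g hg i _ => ?_⟩
    by_cases hi : O i = Set.univ
    · simp [hi]
    · rw [hg i hi]
      exact hf i trivial
  | univ => exact ⟨∅, by simpa using aleph0_pos.trans_le hκ, fun _ _ => trivial⟩
  | inter V W _ _ hV hW =>
    obtain ⟨S, hS, hSV⟩ := hV hf.1
    obtain ⟨S', hS', hSW⟩ := hW hf.2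
    exact ⟨S ∪ S', (mk_union_le S S').trans_lt (add_lt_of_lt hκ hS hS'), fun g hg =>
      ⟨hSV g fun i hi => hg i (Or.inl hi), hSW g fun i hi => hg i (Or.inr hi)⟩⟩
  | sUnion 𝒮 _ ih =>
    obtain ⟨V, hV, hfV⟩ := hf
    obtain ⟨S, hS, hSV⟩ := ih V hV hfV
    exact ⟨S, hS, fun g hg => ⟨V, hV, hSV g hg⟩⟩

section UncoveredNode

variable {K : Type u} [LinearOrder K]

/-- The sequences agreeing with `s` below `a`. -/
def initialCylinder (a : K) (s : K → Bool) : Set (K → Bool) :=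
  {f | ∀ x < a, f x = s x}

/-- A binary sequence of length `height` (padded by `false`) whose cylinder is not contained in
any member of `𝒰`. -/
@[ext]
structure UncoveredNode (𝒰 : Set (Set (K → Bool))) where
  height : K
  seq : K → Bool
  seq_eq_false : ∀ x, height ≤ x → seq x = false
  not_subset : ∀ U ∈ 𝒰, ¬ initialCylinder height seq ⊆ U

namespace UncoveredNode

variable {𝒰 : Set (Set (K → Bool))}

theorem eq_of_height_eq {p q : UncoveredNode 𝒰} (h : p.height = q.height)
    (hs : ∀ x < p.height, p.seq x = q.seq x) : p = q := by
  refine UncoveredNode.ext h (funext fun x => ?_)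
  rcases lt_or_ge x p.height with hx | hx
  · exact hs x hx
  · rw [p.seq_eq_false x hx, q.seq_eq_false x (h ▸ hx)]

/-- Nodes are ordered by end-extension of sequences. -/
instance : PartialOrder (UncoveredNode 𝒰) where
  le p q := p.height ≤ q.height ∧ ∀ x < p.height, p.seq x = q.seq x
  le_refl p := ⟨le_rfl, fun _ _ => rfl⟩
  le_trans p q r hpq hqr := ⟨hpq.1.trans hqr.1, fun x hx =>
    (hpq.2 x hx).trans (hqr.2 x (hx.trans_le hpq.1))⟩
  le_antisymm p q hpq hqp := eq_of_height_eq (hpq.1.antisymm hqp.1) hpq.2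

theorem height_lt_height {p q : UncoveredNode 𝒰} (h : p < q) : p.height < q.height :=
  h.le.1.lt_of_ne fun he => h.ne (eq_of_height_eq he h.le.2)

theorem lt_iff {p q : UncoveredNode 𝒰} :
    p < q ↔ p.height < q.height ∧ ∀ x < p.height, p.seq x = q.seq x :=
  ⟨fun h => ⟨height_lt_height h, h.le.2⟩, fun h =>
    lt_of_le_of_ne ⟨h.1.le, h.2⟩ fun he => h.1.ne (congrArg height he)⟩

/-- The restriction of a node to a smaller height. -/
def restrict (t : UncoveredNode 𝒰) (a : K) (ha : a ≤ t.height) : UncoveredNode 𝒰 where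
  height := a
  seq x := if x < a then t.seq x else false
  seq_eq_false x hx := by simp [hx.not_gt]
  not_subset U hU h := t.not_subset U hU fun f hf => h fun x hx => by
    simpa [hx] using hf x (hx.trans_le ha)

/-- The predecessors of a node correspond to the heights below its own. -/
def predecessorsIso (t : UncoveredNode 𝒰) :
    (fun a b : {s : UncoveredNode 𝒰 // s < t} => (a : UncoveredNode 𝒰) < b) ≃r
      Subrel (fun x y : K => x < y) (fun x => x < t.height) where
  toFun s := ⟨s.1.height, height_lt_height s.2⟩
  invFun a := ⟨t.restrict a.1 a.2.le, lt_iff.2 ⟨a.2, fun _ hx => if_pos hx⟩⟩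
  left_inv s := Subtype.ext <| eq_of_height_eq rfl fun x hx =>
    (if_pos hx).trans (s.2.le.2 x hx).symm
  right_inv _ := rfl
  map_rel_iff' {a b} := ⟨fun h => lt_iff.2 ⟨h, fun x hx =>
    (a.2.le.2 x hx).trans (b.2.le.2 x (lt_trans hx h)).symm⟩, height_lt_height⟩

variable [WellFoundedLT K]

theorem isWellOrder_predecessors (t : UncoveredNode 𝒰) :
    IsWellOrder {s : UncoveredNode 𝒰 // s < t}
      (fun a b => (a : UncoveredNode 𝒰) < (b : UncoveredNode 𝒰)) :=
  t.predecessorsIso.toRelEmbedding.isWellOrder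

theorem treeLevel_eq (t : UncoveredNode 𝒰) :
    treeLevel isWellOrder_predecessors t = Ordinal.typein (fun x y : K => x < y) t.height := by
  let := t.isWellOrder_predecessors
  rw [← Ordinal.type_subrel]
  exact Ordinal.type_eq.2 ⟨t.predecessorsIso⟩

end UncoveredNode

/-- A chain of `#K` many nodes, each initial segment of `K` being smaller than `K`, has
unbounded heights. -/
theorem exists_lt_height_of_isChain {𝒰 : Set (Set (K → Bool))} {κ : Cardinal.{u}}
    (hIio : ∀ a : K, #(Set.Iio a) < κ) (hκ : ℵ₀ ≤ κ) {B : Set (UncoveredNode 𝒰)}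
    (hB : IsChain (· ≤ ·) B) (hcard : #B = κ) (a : K) : ∃ p ∈ B, a < p.height := by
  by_contra! hle
  have hinj : Function.Injective
      fun p : B => (⟨p.1.height, hle p.1 p.2⟩ : Set.Iic a) := by
    intro p q hpq
    have hheight : p.1.height = q.1.height := congrArg Subtype.val hpq
    refine Subtype.ext ?_
    rcases hB.total p.2 q.2 with h | h
    · exact UncoveredNode.eq_of_height_eq hheight h.2
    · exact (UncoveredNode.eq_of_height_eq hheight.symm h.2).symm
  have hIic : #(Set.Iic a) < κ := by
    rw [← Set.Iio_insert]
    exact (mk_insert_le).trans_lt (add_lt_of_lt hκ (hIio a) (one_lt_aleph0.trans_le hκ))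
  exact (hcard ▸ mk_le_of_injective hinj).not_gt hIic

end UncoveredNode

/-- If every sequence of some length has its cylinder inside a member of a family, then few
members of the family suffice to cover. -/
theorem exists_small_subcover_of_cylinders {K : Type u} [LinearOrder K] {κ : Cardinal.{u}}
    (hκ : IsStrongPrelimit κ) {𝒰 : Set (Set (K → Bool))} {a : K} (ha : #(Set.Iio a) < κ)
    (h : ∀ s : K → Bool, ∃ U ∈ 𝒰, initialCylinder a s ⊆ U) :
    ∃ 𝒱 ⊆ 𝒰, #𝒱 < κ ∧ ⋃₀ 𝒱 = Set.univ := by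
  choose U hU hsub using h
  let extend (g : Set.Iio a → Bool) (x : K) : Bool := if hx : x < a then g ⟨x, hx⟩ else false
  refine ⟨Set.range fun g => U (extend g), ?_, mk_range_le.trans_lt ?_, ?_⟩
  · rintro _ ⟨g, rfl⟩
    exact hU _
  · simpa using hκ ha
  · refine Set.eq_univ_of_forall fun f => ?_
    exact ⟨_, ⟨fun x => f x, rfl⟩, hsub _ fun x hx => by simp [extend, hx]⟩

/-- The `(<κ)`-box topology on binary sequences indexed by a well-order of type `κ`, for `κ`
weakly compact, is `(<κ)`-compact. -/
theorem WeaklyCompactCard.kappaCompactSpace_box {κ : Cardinal.{u}} (h : WeaklyCompactCard κ)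
    {K : Type u} [LinearOrder K] [WellFoundedLT K] (hK : Ordinal.type (α := K) (· < ·) = κ.ord) :
    @KappaCompactSpace κ (K → Bool) (boxTopology κ fun _ : K => Bool) := by
  obtain ⟨hinacc, htree⟩ := h
  have hκ : ℵ₀ ≤ κ := hinacc.aleph0_lt.le
  intro 𝒰 hopen hcover
  have hIio (a : K) : #(Set.Iio a) < κ := by
    have hcardK : #K = κ := by rw [← Ordinal.card_type (α := K) (· < ·), hK, card_ord]
    exact (mk_Iio_lt a (by rw [hcardK, hK])).trans_eq hcardK
  by_contra hno
  obtain ⟨B, hB, hcard⟩ := htree (UncoveredNode 𝒰) UncoveredNode.isWellOrder_predecessors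
    (fun t => by rw [t.treeLevel_eq, ← hK]; exact Ordinal.typein_lt_type _ _)
    (fun β hβ => by
      obtain ⟨a, rfl⟩ := Ordinal.typein_surj (fun x y : K => x < y) (hK ▸ hβ)
      by_contra! hnone
      refine hno (exists_small_subcover_of_cylinders hinacc.isStrongPrelimit (hIio a) fun s => ?_)
      by_contra! hs
      refine hnone ⟨a, fun x => if x < a then s x else false, fun x hx => if_neg hx.not_gt,
        fun U hU hsub => hs U hU fun f hf => hsub fun x hx => ?_⟩
        (UncoveredNode.treeLevel_eq _)
      simpa only [if_pos hx] using hf x hx)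
    (fun β => by
      by_cases hne : ∃ t : UncoveredNode 𝒰, treeLevel UncoveredNode.isWellOrder_predecessors t = β
      · obtain ⟨t, rfl⟩ := hne
        have hpow : #(Set.Iio t.height → Bool) < κ := by
          simpa using hinacc.isStrongPrelimit (hIio t.height)
        refine (mk_le_of_injective (f := fun p (x : Set.Iio t.height) => p.1.seq x) ?_).trans_lt hpow
        have hheight (p : {p : UncoveredNode 𝒰 | treeLevel UncoveredNode.isWellOrder_predecessors p =
            treeLevel UncoveredNode.isWellOrder_predecessors t}) : p.1.height = t.height :=
          Ordinal.typein_injective _ <|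
            (p.1.treeLevel_eq.symm.trans p.2).trans t.treeLevel_eq
        intro p q hpq
        exact Subtype.ext (UncoveredNode.eq_of_height_eq ((hheight p).trans (hheight q).symm)
          fun x hx => congrFun hpq ⟨x, hheight p ▸ hx⟩)
      · push Not at hne
        simpa [hne] using hinacc.pos)
  have hunbdd := exists_lt_height_of_isChain hIio hκ hB hcard
  choose node hnode hlt using hunbdd
  let f (x : K) : Bool := (node x).seq x
  have hf : ∀ p ∈ B, f ∈ initialCylinder p.height p.seq := by
    intro p hp x hx
    rcases hB.total hp (hnode x) with hle | hle
    · exact (hle.2 x hx).symm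
    · exact hle.2 x (hlt x)
  obtain ⟨U, hU, hfU⟩ : f ∈ ⋃₀ 𝒰 := hcover ▸ Set.mem_univ f
  obtain ⟨S, hS, hSU⟩ := exists_agree_subset_of_isOpen_boxTopology hκ (hopen U hU) hfU
  have hcof : κ ≤ Order.cof K := by
    rw [← Ordinal.cof_type, hK]
    exact hinacc.le_cof_ord
  obtain ⟨b, hb⟩ := not_isCofinal_iff.1 fun hcofinal =>
    ((Order.cof_le hcofinal).trans_lt hS).not_ge hcof
  refine (node b).not_subset U hU fun g hg => hSU g fun i hi => ?_
  have hi' : i < (node b).height := (hb i hi).trans (hlt b)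
  exact (hg i hi').trans (hf _ (hnode b) i hi').symm

theorem weaklyCompact_to_box_compact (κ : Cardinal.{u}) (h : WeaklyCompactCard κ) :
    @KappaCompactSpace κ (κ.out → Bool) (boxTopology κ fun _ : κ.out => Bool) := by
  classical
  obtain ⟨r, hr, hord⟩ := exists_ord_eq κ.out
  let := linearOrderOfSTO r
  have : WellFoundedLT κ.out := ⟨hr.wf⟩
  exact h.kappaCompactSpace_box (hord.symm.trans (by rw [mk_out]))
end

section
/- Suppose κ = κ^{<κ} > ℵ₀. Then κ is weakly compact if and only if for every Γ ≤ κ and every family {X_γ : γ ∈ Γ} of (<κ)-compact Hausdorff spaces with w(X_γ) ≤ κ for all γ, the product Π_{γ∈Γ} X_γ with the (<κ)-box topology is (<κ)-compact; and this holds if and only if every such product with the Tychonoff product topology is (<κ)-compact. -/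
universe u v

open Cardinal TopologicalSpace

theorem Cardinal.isRegular_of_powerlt_eq_self {κ : Cardinal.{u}} (hκ : ℵ₀ ≤ κ)
    (hcard : κ ^< κ = κ) : κ.IsRegular := by
  refine ⟨hκ, ?_⟩
  by_contra! h
  exact ((lt_power_cof_ord hκ).trans_le (le_powerlt κ h)).ne hcard.symm

theorem Cardinal.IsRegular.exists_forall_mem_lt {κ : Cardinal.{u}} (hκ : κ.IsRegular)
    {S : Set κ.ord.ToType} (hS : #S < κ) : ∃ δ, ∀ s ∈ S, s < δ := by
  by_contra! h
  have := Order.cof_le (s := S) h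
  rw [Ordinal.cof_toType, hκ.cof_ord] at this
  exact hS.not_ge this

theorem Cardinal.exists_embedding_ord_toType {κ : Cardinal.{u}} {α : Type u} (h : #α ≤ κ) :
    Nonempty (α ↪ κ.ord.ToType) := by
  rwa [← Cardinal.le_def, mk_ord_toType]

theorem KappaCompactSpace.of_coarser {κ : Cardinal.{u}} {X : Type u} {s t : TopologicalSpace X}
    (hst : s ≤ t) (hs : @KappaCompactSpace κ X s) : @KappaCompactSpace κ X t :=
  fun 𝒰 h𝒰 hcov => hs 𝒰 (fun U hU => hst U (h𝒰 U hU)) hcov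

theorem kappaCompactSpace_of_card_lt {κ : Cardinal.{u}} {X : Type u} [TopologicalSpace X]
    (h : #X < κ) : KappaCompactSpace κ X := by
  intro 𝒰 _ hcov
  have hx : ∀ x : X, ∃ U ∈ 𝒰, x ∈ U := fun x => by
    simpa using hcov.ge (Set.mem_univ x)
  choose U hU hxU using hx
  refine ⟨Set.range U, by rintro _ ⟨x, rfl⟩; exact hU x, mk_range_le.trans_lt h, ?_⟩
  exact Set.eq_univ_of_forall fun x => ⟨U x, ⟨x, rfl⟩, hxU x⟩

theorem boxTopology_le_pi {κ : Cardinal.{u}} (hκ : ℵ₀ ≤ κ) {ι : Type u} (X : ι → Type v)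
    [∀ i, TopologicalSpace (X i)] : boxTopology κ X ≤ Pi.topologicalSpace := by
  classical
  refine le_iInf fun i => ?_
  rw [← continuous_iff_le_induced]
  refine @Continuous.mk _ _ (boxTopology κ X) _ _ fun U hU => ?_
  refine TopologicalSpace.isOpen_generateFrom_of_mem
    ⟨Function.update (fun _ => Set.univ) i U, fun j => ?_, ?_, ?_⟩
  · obtain rfl | hj := eq_or_ne j i <;> simp [*]
  · refine lt_of_le_of_lt (mk_le_mk_of_subset (t := {i}) fun j hj => ?_) ?_
    · by_contra hji
      exact hj (Function.update_of_ne hji ..)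
    · simpa using one_lt_aleph0.trans_le hκ
  · ext f
    refine ⟨fun hf j _ => ?_, fun hf => by simpa using hf i (Set.mem_univ i)⟩
    obtain rfl | hj := eq_or_ne j i
    · simpa using hf
    · simp [hj]

theorem exists_box_subset {κ : Cardinal.{u}} (hκ : ℵ₀ ≤ κ) {ι : Type u} {X : ι → Type v}
    [∀ i, TopologicalSpace (X i)] {U : Set (∀ i, X i)} (hU : @IsOpen _ (boxTopology κ X) U)
    {x : ∀ i, X i} (hx : x ∈ U) :
    ∃ O : ∀ i, Set (X i), (∀ i, IsOpen (O i)) ∧ #{i | O i ≠ Set.univ} < κ ∧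
      x ∈ Set.univ.pi O ∧ Set.univ.pi O ⊆ U := by
  induction hU with
  | basic B hB =>
    obtain ⟨O, hO, hc, rfl⟩ := hB
    exact ⟨O, hO, hc, hx, subset_rfl⟩
  | univ =>
    refine ⟨fun _ => Set.univ, fun _ => isOpen_univ, ?_, by simp, Set.subset_univ _⟩
    simpa using aleph0_pos.trans_le hκ
  | inter s t _ _ ihs iht =>
    obtain ⟨O, hO, hOc, hxO, hOs⟩ := ihs hx.1
    obtain ⟨O', hO', hOc', hxO', hOt⟩ := iht hx.2
    refine ⟨fun i => O i ∩ O' i, fun i => (hO i).inter (hO' i), ?_,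
      fun i hi => ⟨hxO i hi, hxO' i hi⟩,
      fun y hy => ⟨hOs fun i hi => (hy i hi).1, hOt fun i hi => (hy i hi).2⟩⟩
    refine lt_of_le_of_lt ((mk_le_mk_of_subset
      (t := {i | O i ≠ Set.univ} ∪ {i | O' i ≠ Set.univ}) fun i hi => ?_).trans
      (mk_union_le _ _)) (add_lt_of_lt hκ hOc hOc')
    by_contra h
    simp only [Set.mem_union, Set.mem_ofPred_eq, not_or, not_not] at h
    exact hi (by simp [h.1, h.2])
  | sUnion S _ ih =>
    obtain ⟨s, hs, hxs⟩ := hx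
    obtain ⟨O, hO, hc, hxO, hOs⟩ := ih s hs hxs
    exact ⟨O, hO, hc, hxO, hOs.trans (Set.subset_sUnion_of_mem hs)⟩

/-- The nodes `(δ, s)` of a tree of subsets of initial segments of `K`, where `s ⊆ Iio δ`
satisfies `P δ s`; nodes are ordered by end extension. -/
structure SegmentNode {K : Type u} [LinearOrder K] (P : K → Set K → Prop) where
  height : K
  carrier : Set K
  carrier_subset : carrier ⊆ Set.Iio height
  prop : P height carrier

namespace SegmentNode

variable {K : Type u} [LinearOrder K] {P : K → Set K → Prop}

theorem ext_of {p q : SegmentNode P} (h : p.height = q.height) (h' : p.carrier = q.carrier) :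
    p = q := by
  cases p; cases q; simp_all

instance : PartialOrder (SegmentNode P) where
  le p q := p.height ≤ q.height ∧ p.carrier = q.carrier ∩ Set.Iio p.height
  le_refl p := ⟨le_rfl, (Set.inter_eq_left.2 p.carrier_subset).symm⟩
  le_trans p q r hpq hqr := by
    refine ⟨hpq.1.trans hqr.1, ?_⟩
    rw [hpq.2, hqr.2, Set.inter_assoc, Set.Iio_inter_Iio, min_eq_right hpq.1]
  le_antisymm p q hpq hqp := by
    have h := le_antisymm hpq.1 hqp.1
    refine ext_of h ?_
    rw [hpq.2, h]
    exact Set.inter_eq_left.2 q.carrier_subset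

theorem eq_of_le_of_height_eq {p q : SegmentNode P} (h : p ≤ q) (h' : p.height = q.height) :
    p = q := by
  refine ext_of h' ?_
  rw [h.2, h']
  exact Set.inter_eq_left.2 q.carrier_subset

theorem lt_iff {p q : SegmentNode P} :
    p < q ↔ p.height < q.height ∧ p.carrier = q.carrier ∩ Set.Iio p.height := by
  refine ⟨fun h => ⟨h.le.1.lt_of_ne fun h' => h.ne (eq_of_le_of_height_eq h.le h'), h.le.2⟩,
    fun h => lt_of_le_of_ne ⟨h.1.le, h.2⟩ fun h' => h.1.ne (congrArg height h')⟩

/-- The predecessors of a node are order isomorphic to the initial segment below its height,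
provided that nodes can be restricted. -/
def predRelIso (hP : ∀ δ s, P δ s → ∀ ε < δ, P ε (s ∩ Set.Iio ε)) (t : SegmentNode P) :
    (fun a b : {s : SegmentNode P // s < t} => (a : SegmentNode P) < (b : SegmentNode P)) ≃r
      ((· < ·) : Set.Iio t.height → Set.Iio t.height → Prop) where
  toFun s := ⟨s.1.height, (lt_iff.1 s.2).1⟩
  invFun a := ⟨⟨a.1, t.carrier ∩ Set.Iio a.1, Set.inter_subset_right, hP _ _ t.prop _ a.2⟩,
    lt_iff.2 ⟨a.2, rfl⟩⟩
  left_inv s := Subtype.ext (ext_of rfl (lt_iff.1 s.2).2.symm)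
  right_inv a := rfl
  map_rel_iff' {a b} := by
    refine ⟨fun h => lt_iff.2 ⟨h, ?_⟩, fun h => (lt_iff.1 h).1⟩
    have h' : a.1.height < b.1.height := h
    rw [(lt_iff.1 a.2).2, (lt_iff.1 b.2).2, Set.inter_assoc, Set.Iio_inter_Iio,
      min_eq_right h'.le]

end SegmentNode

theorem WeaklyCompactCard.exists_forall_not_small {κ : Cardinal.{u}} (hκ : WeaklyCompactCard κ)
    {Y : Type u} (Small : Set Y → Prop) (mono : ∀ s t, s ⊆ t → Small t → Small s)
    (iUnion : ∀ (ι : Type u) (f : ι → Set Y), #ι < κ → (∀ i, Small (f i)) → Small (⋃ i, f i))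
    (huniv : ¬ Small Set.univ) (A : κ.ord.ToType → Set Y) :
    ∃ F : Set κ.ord.ToType, ∀ δ, ¬ Small {y | ∀ a < δ, a ∈ F ↔ y ∈ A a} := by
  let P : κ.ord.ToType → Set κ.ord.ToType → Prop :=
    fun δ s => ¬ Small {y | ∀ a < δ, a ∈ s ↔ y ∈ A a}
  have hP : ∀ δ s, P δ s → ∀ ε < δ, P ε (s ∩ Set.Iio ε) := by
    refine fun δ s h ε hε h' => h (mono _ _ ?_ h')
    intro y hy a ha
    rw [← hy a (ha.trans hε)]
    exact and_iff_left ha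
  have hpow : ∀ δ : κ.ord.ToType, #(𝒫 (Set.Iio δ)) < κ := fun δ => by
    rw [mk_powerset]
    exact hκ.1.isStrongPrelimit (by simpa using mk_Iio_lt δ)
  let T := SegmentNode P
  have hwo : ∀ t : T, IsWellOrder {s : T // s < t} (fun a b => (a : T) < (b : T)) :=
    fun t => (SegmentNode.predRelIso hP t).toRelEmbedding.isWellOrder
  have hlevel : ∀ t : T, treeLevel hwo t =
      Ordinal.typein (α := κ.ord.ToType) (· < ·) t.height := fun t =>
    have := hwo t
    (SegmentNode.predRelIso hP t).ordinalType_congr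
  obtain ⟨B, hB, hBcard⟩ := hκ.2 T hwo (fun t => by
      rw [hlevel]
      exact Ordinal.typein_lt_self _) (fun β hβ => by
      obtain ⟨δ, rfl⟩ := Ordinal.typein_surj (α := κ.ord.ToType) (· < ·)
        (by rwa [Ordinal.type_toType])
      by_contra! h
      refine huniv (mono _ _ ?_ (iUnion (𝒫 (Set.Iio δ))
        (fun s => {y | ∀ a < δ, a ∈ s.1 ↔ y ∈ A a}) (hpow δ) fun s => ?_))
      · exact fun y _ => Set.mem_iUnion.2
          ⟨⟨{a | a < δ ∧ y ∈ A a}, fun a ha => ha.1⟩, fun a ha => and_iff_right ha⟩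
      · by_contra hs
        exact h ⟨δ, s.1, s.2, hs⟩ (hlevel _)) (fun β => by
      rcases Set.eq_empty_or_nonempty {t : T | treeLevel hwo t = β} with h | ⟨t₀, ht₀⟩
      · rw [h]
        simpa using hκ.1.pos
      · refine lt_of_le_of_lt (mk_le_of_injective (β := 𝒫 (Set.Iio t₀.height))
          (f := fun t => ⟨t.1.carrier, ?_⟩) ?_) (hpow t₀.height)
        all_goals
          have key : ∀ t : {t : T | treeLevel hwo t = β}, t.1.height = t₀.height := fun t =>
            Ordinal.typein_injective (α := κ.ord.ToType) (· < ·)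
              (by rw [← hlevel, ← hlevel, t.2, ht₀])
        · rw [← key t]
          exact t.1.carrier_subset
        · intro s t hst
          exact Subtype.ext (SegmentNode.ext_of ((key s).trans (key t).symm)
            (congrArg Subtype.val hst)))
  have hunb : ∀ δ, ∃ t ∈ B, δ ≤ t.height := by
    intro δ
    by_contra! h
    refine (mk_le_of_injective (α := B) (β := Set.Iio δ)
      (f := fun t => ⟨t.1.height, h t.1 t.2⟩) fun s t hst => ?_).not_gt ?_
    · have hst' : s.1.height = t.1.height := congrArg Subtype.val hst
      rcases hB.total s.2 t.2 with h | h
      · exact Subtype.ext (SegmentNode.eq_of_le_of_height_eq h hst')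
      · exact Subtype.ext (SegmentNode.eq_of_le_of_height_eq h hst'.symm).symm
    · rw [hBcard]
      simpa using mk_Iio_lt δ
  refine ⟨⋃ t ∈ B, t.carrier, fun δ h => ?_⟩
  obtain ⟨t, htB, ht⟩ := hunb δ
  refine t.prop (mono _ _ ?_ h)
  intro y hy a ha
  rw [← hy a (ha.trans_le ht)]
  simp only [Set.mem_iUnion, exists_prop]
  refine ⟨fun ⟨s, hs, has⟩ => ?_, fun h => ⟨t, htB, h⟩⟩
  rcases hB.total hs htB with h | h
  · rw [h.2] at has
    exact has.1
  · rw [h.2]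
    exact ⟨has, ha.trans_le ht⟩

theorem WeaklyCompactCard.kappaCompactSpace_boxTopology {κ : Cardinal.{u}}
    (hκ : WeaklyCompactCard κ) {ι : Type u} (X : ι → Type u) [∀ i, TopologicalSpace (X i)]
    (hι : #ι ≤ κ) (hX : ∀ i, KappaCompactSpace κ (X i)) (hw : ∀ i, WeightLE (X i) κ) :
    @KappaCompactSpace κ (∀ i, X i) (boxTopology κ X) := by
  intro 𝒰 h𝒰 hcov
  by_contra hno
  have hreg := hκ.1.isRegular
  choose B hB hBcard using hw
  obtain ⟨e⟩ : Nonempty ((Σ i, B i) ↪ κ.ord.ToType) := by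
    refine exists_embedding_ord_toType ?_
    rw [mk_sigma]
    calc Cardinal.sum (fun i => #(B i)) ≤ Cardinal.sum fun _ : ι => κ := sum_le_sum _ _ hBcard
      _ = #ι * κ := by simp
      _ ≤ κ * κ := by gcongr
      _ = κ := mul_eq_self hreg.aleph0_le
  obtain ⟨F, hF⟩ := hκ.exists_forall_not_small (Y := ∀ i, X i)
    (fun Z => ∃ 𝒱 ⊆ 𝒰, #𝒱 < κ ∧ Z ⊆ ⋃₀ 𝒱)
    (fun s t hst ⟨𝒱, h, hc, ht⟩ => ⟨𝒱, h, hc, hst.trans ht⟩)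
    (fun J f hJ hf => by
      choose 𝒱 h hc hs using hf
      refine ⟨⋃ j, 𝒱 j, Set.iUnion_subset h,
        (card_iUnion_lt_iff_forall_of_isRegular hreg hJ).2 hc, Set.iUnion_subset fun j => ?_⟩
      exact (hs j).trans (Set.sUnion_subset_sUnion (Set.subset_iUnion 𝒱 j)))
    (fun ⟨𝒱, h, hc, hs⟩ => hno ⟨𝒱, h, hc, Set.univ_subset_iff.1 hs⟩)
    (fun a => {x | ∃ j, e j = a ∧ x j.1 ∈ j.2.1})
  have hmem : ∀ (x : ∀ i, X i) (j : Σ i, B i), (∃ k, e k = e j ∧ x k.1 ∈ k.2.1) ↔ x j.1 ∈ j.2.1 :=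
    fun x j => ⟨fun ⟨k, hk, h⟩ => e.injective hk ▸ h, fun h => ⟨j, rfl, h⟩⟩
  have hpoint : ∀ i, ∃ x : X i, ∀ b : B i, x ∈ b.1 → e ⟨i, b⟩ ∈ F := by
    intro i
    by_contra! h
    obtain ⟨𝒱, h𝒱, hc, hs⟩ := hX i (Subtype.val '' {b : B i | e ⟨i, b⟩ ∉ F})
      (by rintro _ ⟨b, -, rfl⟩; exact (hB i).isOpen b.2)
      (Set.eq_univ_of_forall fun x => by
        obtain ⟨b, hxb, hb⟩ := h x
        exact ⟨b, ⟨b, hb, rfl⟩, hxb⟩)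
    choose b hb hb𝒱 using fun V : 𝒱 => h𝒱 V.2
    obtain ⟨δ, hδ⟩ := hreg.exists_forall_mem_lt
      (S := Set.range fun V : 𝒱 => e ⟨i, b V⟩) (mk_range_le.trans_lt hc)
    refine hF δ ⟨∅, Set.empty_subset _, by simpa using hreg.pos, fun y hy => ?_⟩
    obtain ⟨V, hV, hyV⟩ := hs.ge (Set.mem_univ (y i))
    refine absurd ((hy (e ⟨i, b ⟨V, hV⟩⟩) (hδ _ ⟨_, rfl⟩)).2 ((hmem y _).2 ?_)) (hb ⟨V, hV⟩)
    simpa [hb𝒱] using hyV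
  choose x hx using hpoint
  obtain ⟨U, hU, hxU⟩ := hcov.ge (Set.mem_univ x)
  obtain ⟨O, hO, hc, hxO, hOU⟩ := exists_box_subset hreg.aleph0_le (h𝒰 U hU) hxU
  choose b hb hxb hbO using fun i => (hB i).exists_subset_of_mem_open (hxO i trivial) (hO i)
  obtain ⟨δ, hδ⟩ := hreg.exists_forall_mem_lt
    (S := (fun i => e ⟨i, b i, hb i⟩) '' {i | O i ≠ Set.univ}) (mk_image_le.trans_lt hc)
  refine hF δ ⟨{U}, Set.singleton_subset_iff.2 hU,
    by simpa using one_lt_aleph0.trans_le hreg.aleph0_le, fun y hy => ?_⟩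
  rw [Set.sUnion_singleton]
  refine hOU fun i _ => ?_
  by_cases hi : O i = Set.univ
  · simp [hi]
  · exact hbO i ((hmem y _).1 ((hy _ (hδ _ ⟨i, hi, rfl⟩)).1 (hx i ⟨b i, hb i⟩ (hxb i))))

theorem exists_lt_treeLevel_eq {T : Type u} [PartialOrder T]
    (h : ∀ t : T, IsWellOrder {s : T // s < t} (fun a b => (a : T) < (b : T)))
    (t : T) {β : Ordinal.{u}} (hβ : β < treeLevel h t) : ∃ s < t, treeLevel h s = β := by
  have := h t
  obtain ⟨s, rfl⟩ := Ordinal.typein_surj (fun a b : {s : T // s < t} => (a : T) < (b : T)) hβ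
  refine ⟨s.1, s.2, ?_⟩
  have := h s.1
  let f : (fun a b : {r : T // r < s.1} => (a : T) < (b : T)) ≃r
      Subrel (fun a b : {r : T // r < t} => (a : T) < (b : T)) (fun r => r.1 < s.1) :=
    { toFun := fun r => ⟨⟨r.1, r.2.trans s.2⟩, r.2⟩
      invFun := fun r => ⟨r.1.1, r.2⟩
      left_inv := fun _ => rfl
      right_inv := fun _ => rfl
      map_rel_iff' := Iff.rfl }
  exact f.ordinalType_congr

theorem treeLevel_strictMono {T : Type u} [PartialOrder T]
    (h : ∀ t : T, IsWellOrder {s : T // s < t} (fun a b => (a : T) < (b : T)))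
    {s t : T} (hst : s < t) : treeLevel h s < treeLevel h t := by
  have := h t
  have := h s
  let f : (fun a b : {r : T // r < s} => (a : T) < (b : T)) ≃r
      Subrel (fun a b : {r : T // r < t} => (a : T) < (b : T)) (fun r => r.1 < s) :=
    { toFun := fun r => ⟨⟨r.1, r.2.trans hst⟩, r.2⟩
      invFun := fun r => ⟨r.1.1, r.2⟩
      left_inv := fun _ => rfl
      right_inv := fun _ => rfl
      map_rel_iff' := Iff.rfl }
  refine (f.ordinalType_congr).trans_lt (?_ : Ordinal.typein _ (⟨s, hst⟩ : {r : T // r < t}) < _)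
  exact Ordinal.typein_lt_type _ _

theorem eq_of_treeLevel_eq {T : Type u} [PartialOrder T]
    (h : ∀ t : T, IsWellOrder {s : T // s < t} (fun a b => (a : T) < (b : T)))
    {r s t : T} (hr : r < t) (hs : s < t) (hrs : treeLevel h r = treeLevel h s) : r = s := by
  have := h t
  rcases (trichotomous_of (fun a b : {s : T // s < t} => (a : T) < (b : T)) ⟨r, hr⟩ ⟨s, hs⟩) with
    h' | h' | h'
  · exact absurd hrs (treeLevel_strictMono h h').ne
  · exact congrArg Subtype.val h'
  · exact absurd hrs (treeLevel_strictMono h h').ne'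

theorem treeProperty_of_kappaCompactSpace_pi {κ : Cardinal.{u}} (hκ : κ.IsRegular)
    (H : ∀ X : κ.ord.ToType → Type u, (∀ i, #(X i) < κ) →
      @KappaCompactSpace κ (∀ i, X i) (@Pi.topologicalSpace _ _ fun _ => ⊥)) :
    TreeProperty κ := by
  intro T _ hwo hlt hex hsmall
  let K := κ.ord.ToType
  let lev : K → Ordinal.{u} := Ordinal.typein (α := κ.ord.ToType) (· < ·)
  have hlev : ∀ {a b : K}, lev a < lev b ↔ a < b := Ordinal.typein_lt_typein _
  let X : K → Type u := fun a => {t : T | treeLevel hwo t = lev a}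
  let : ∀ a, TopologicalSpace (X a) := fun _ => ⊥
  have : ∀ a, DiscreteTopology (X a) := fun _ => ⟨rfl⟩
  have hX : ∀ a, Nonempty (X a) := fun a => by
    obtain ⟨t, ht⟩ := hex (lev a) (Ordinal.typein_lt_self a)
    exact ⟨⟨t, ht⟩⟩
  let V : K × K → Set (∀ a, X a) := fun p => {f | p.1 < p.2 ∧ ¬ (f p.1).1 < (f p.2).1}
  have hV : ∀ p, IsOpen (V p) := fun p => by
    have : V p = (fun f : ∀ a, X a => (f p.1, f p.2)) ⁻¹'
        {q | p.1 < p.2 ∧ ¬ q.1.1 < q.2.1} := rfl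
    rw [this]
    exact (isOpen_discrete _).preimage (by fun_prop)
  suffices ∃ f : ∀ a, X a, ∀ a b, a < b → (f a).1 < (f b).1 by
    obtain ⟨f, hf⟩ := this
    have hmono : StrictMono fun a => (f a).1 := fun a b => hf a b
    refine ⟨Set.range fun a => (f a).1, hmono.monotone.isChain_range, ?_⟩
    rw [mk_range_eq _ hmono.injective, mk_ord_toType]
  by_contra! hno
  obtain ⟨𝒱, h𝒱, hc, hs⟩ := H X (fun a => hsmall _) (Set.range V)
    (by rintro _ ⟨p, rfl⟩; exact hV p) (Set.eq_univ_of_forall fun f => by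
      obtain ⟨a, b, hab, h⟩ := hno f
      exact ⟨V (a, b), ⟨_, rfl⟩, hab, h⟩)
  choose p hp using fun U : 𝒱 => h𝒱 U.2
  obtain ⟨δ, hδ⟩ := hκ.exists_forall_mem_lt (S := Set.range fun U => (p U).2)
    (mk_range_le.trans_lt hc)
  obtain ⟨t, ht⟩ := (hX δ).some
  have hpred : ∀ a, ∃ x : X a, a < δ → x.1 < t := fun a => by
    by_cases ha : a < δ
    · obtain ⟨s, hst, hs⟩ := exists_lt_treeLevel_eq hwo t (ht ▸ hlev.2 ha : lev a < _)
      exact ⟨⟨s, hs⟩, fun _ => hst⟩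
    · exact ⟨(hX a).some, fun h => absurd h ha⟩
  choose f hf using hpred
  obtain ⟨U, hU, hfU⟩ := hs.ge (Set.mem_univ f)
  replace hfU : f ∈ V (p ⟨U, hU⟩) := (hp ⟨U, hU⟩).symm ▸ hfU
  set q := p ⟨U, hU⟩
  have hq2 : q.2 < δ := hδ _ ⟨_, rfl⟩
  obtain ⟨s, hsq, hs⟩ := exists_lt_treeLevel_eq hwo (f q.2).1
    ((f q.2).2.symm ▸ hlev.2 hfU.1 : lev q.1 < _)
  refine hfU.2 ?_
  rwa [eq_of_treeLevel_eq hwo (hf q.1 (hfU.1.trans hq2)) (hsq.trans (hf _ hq2))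
    ((f q.1).2.trans hs.symm)]

/-- The topology on a linear order generated by the half-open intervals `(a, b]`, in which a least
element is isolated. -/
@[reducible]
def leftHalfOpenTopology (L : Type u) [LinearOrder L] : TopologicalSpace L where
  IsOpen U := ∀ x ∈ U, ∀ y < x, ∃ a < x, Set.Ioc a x ⊆ U
  isOpen_univ := fun _ _ y hy => ⟨y, hy, Set.subset_univ _⟩
  isOpen_inter := fun U V hU hV x hx y hy => by
    obtain ⟨a, ha, haU⟩ := hU x hx.1 y hy
    obtain ⟨b, hb, hbV⟩ := hV x hx.2 y hy
    exact ⟨max a b, max_lt ha hb, fun z hz =>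
      ⟨haU ⟨(le_max_left a b).trans_lt hz.1, hz.2⟩,
        hbV ⟨(le_max_right a b).trans_lt hz.1, hz.2⟩⟩⟩
  isOpen_sUnion := fun S hS x ⟨U, hU, hxU⟩ y hy => by
    obtain ⟨a, ha, haU⟩ := hS U hU x hxU y hy
    exact ⟨a, ha, haU.trans (Set.subset_sUnion_of_mem hU)⟩

namespace LeftHalfOpen

variable {L : Type u} [LinearOrder L]

attribute [local instance] leftHalfOpenTopology

theorem isOpen_def {U : Set L} : IsOpen U ↔ ∀ x ∈ U, ∀ y < x, ∃ a < x, Set.Ioc a x ⊆ U := Iff.rfl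

theorem isOpen_Iic (a : L) : IsOpen (Set.Iic a) :=
  isOpen_def.2 fun _ hx y hy => ⟨y, hy, fun _ hz => hz.2.trans hx⟩

theorem isOpen_Ioi (a : L) : IsOpen (Set.Ioi a) :=
  isOpen_def.2 fun _ hx _ _ => ⟨a, hx, fun _ hz => hz.1⟩

theorem isOpen_Ioc (a b : L) : IsOpen (Set.Ioc a b) :=
  (isOpen_Ioi a).inter (isOpen_Iic b)

theorem t2Space : T2Space L := by
  refine ⟨fun x y hxy => ?_⟩
  wlog h : x < y generalizing x y
  · obtain ⟨u, v, hu, hv, hx, hy, huv⟩ := this y x hxy.symm (hxy.lt_or_gt.resolve_left h)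
    exact ⟨v, u, hv, hu, hy, hx, huv.symm⟩
  · exact ⟨Set.Iic x, Set.Ioi x, isOpen_Iic x, isOpen_Ioi x, le_rfl, h,
      Set.Iic_disjoint_Ioi le_rfl⟩

theorem weightLE {κ : Cardinal.{u}} (hκ : ℵ₀ ≤ κ) (hL : #L ≤ κ) : WeightLE L κ := by
  refine ⟨Set.range (fun p : L × L => Set.Ioc p.1 p.2) ∪ Set.range (fun x : L => Set.Iic x),
    isTopologicalBasis_of_isOpen_of_nhds ?_ ?_, ?_⟩
  · rintro _ (⟨p, rfl⟩ | ⟨x, rfl⟩)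
    · exact isOpen_Ioc _ _
    · exact isOpen_Iic x
  · intro x U hx hU
    by_cases h : ∃ y, y < x
    · obtain ⟨y, hy⟩ := h
      obtain ⟨a, ha, haU⟩ := isOpen_def.1 hU x hx y hy
      exact ⟨_, Or.inl ⟨(a, x), rfl⟩, ⟨ha, le_rfl⟩, haU⟩
    · refine ⟨_, Or.inr ⟨x, rfl⟩, le_rfl, fun z hz => ?_⟩
      rwa [(le_of_not_gt fun h' => h ⟨z, h'⟩ : x ≤ z).antisymm' hz]
  · refine (mk_union_le _ _).trans (add_le_of_le hκ (mk_range_le.trans ?_)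
      (mk_range_le.trans hL))
    rw [mk_prod, lift_id]
    exact (mul_le_mul' hL hL).trans (mul_eq_self hκ).le

theorem kappaCompactSpace {κ : Cardinal.{u}} (hκ : κ.IsRegular) {D : Set L} (hD : #D < κ)
    (hLD : ∀ x y : L, x < y → ∃ d ∈ D, x < d ∧ d ≤ y) : KappaCompactSpace κ L := by
  intro 𝒰 h𝒰 hcov
  have hx : ∀ x : L, ∃ U ∈ 𝒰, x ∈ U := fun x => by simpa using hcov.ge (Set.mem_univ x)
  choose U hU hxU using hx
  have key : ∀ d : D, ∃ 𝒱 ⊆ 𝒰, #𝒱 < κ ∧ {x | d.1 ≤ x ∧ Set.Icc d.1 x ⊆ U x} ⊆ ⋃₀ 𝒱 := by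
    intro d
    set C := {x | d.1 ≤ x ∧ Set.Icc d.1 x ⊆ U x}
    by_cases hmax : ∃ m ∈ C, ∀ x ∈ C, x ≤ m
    · obtain ⟨m, hm, hmax⟩ := hmax
      refine ⟨{U m}, Set.singleton_subset_iff.2 (hU m),
        by simpa using one_lt_aleph0.trans_le hκ.aleph0_le, fun x hx => ?_⟩
      exact ⟨U m, rfl, hm.2 ⟨hx.1, hmax x hx⟩⟩
    · push Not at hmax
      choose g hgC hg using fun e : {e : D // ∃ x ∈ C, e.1 ≤ x} => e.2
      refine ⟨Set.range fun e => U (g e), by rintro _ ⟨e, rfl⟩; exact hU _,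
        (mk_range_le.trans (mk_subtype_le _)).trans_lt hD, fun x hx => ?_⟩
      obtain ⟨y, hy, hxy⟩ := hmax x hx
      obtain ⟨e, he, hxe, hey⟩ := hLD x y hxy
      exact ⟨_, ⟨⟨⟨e, he⟩, y, hy, hey⟩, rfl⟩,
        (hgC ⟨⟨e, he⟩, y, hy, hey⟩).2 ⟨hx.1, hxe.le.trans (hg ⟨⟨e, he⟩, y, hy, hey⟩)⟩⟩
  choose 𝒱 h𝒱 hc hs using key
  refine ⟨(⋃ d, 𝒱 d) ∪ U '' {x | IsMin x},
    Set.union_subset (Set.iUnion_subset h𝒱) (by rintro _ ⟨x, -, rfl⟩; exact hU x), ?_, ?_⟩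
  · refine (mk_union_le _ _).trans_lt (add_lt_of_lt hκ.aleph0_le
      ((card_iUnion_lt_iff_forall_of_isRegular hκ hD).2 hc) (mk_image_le.trans_lt ?_))
    refine lt_of_le_of_lt ?_ (one_lt_aleph0.trans_le hκ.aleph0_le)
    exact mk_le_one_iff_set_subsingleton.2 fun x hx y hy =>
      (le_total x y).elim (fun h => h.antisymm (hy h)) (fun h => (hx h).antisymm h)
  · refine Set.eq_univ_of_forall fun x => ?_
    by_cases hmin : IsMin x
    · exact ⟨U x, Or.inr ⟨x, hmin, rfl⟩, hxU x⟩
    · obtain ⟨y, hy⟩ := not_isMin_iff.1 hmin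
      obtain ⟨a, ha, haU⟩ := isOpen_def.1 (h𝒰 _ (hU x)) x (hxU x) y hy
      obtain ⟨d, hd, had, hdx⟩ := hLD a x ha
      obtain ⟨V, hV, hxV⟩ := hs ⟨d, hd⟩
        (⟨hdx, (Set.Icc_subset_Ioc_left had).trans haU⟩ : x ∈ {x | d ≤ x ∧ Set.Icc d x ⊆ U x})
      exact ⟨V, Or.inl (Set.mem_iUnion.2 ⟨_, hV⟩), hxV⟩

theorem mk_lt_of_kappaCompactSpace_pi {κ : Cardinal.{u}} {neg : L → L} (hneg : StrictAnti neg)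
    (hinv : Function.Involutive neg) (h : KappaCompactSpace κ (ULift.{u} Bool → L)) :
    #L < κ := by
  let g : L → ULift.{u} Bool → L := fun x i => if i.down then x else neg x
  let t : ULift.{u} Bool := ⟨true⟩
  let f : ULift.{u} Bool := ⟨false⟩
  have hbox : ∀ U V : Set L, IsOpen U → IsOpen V →
      IsOpen {p : ULift.{u} Bool → L | p t ∈ U ∧ p f ∈ V} := fun U V hU hV =>
    (hU.preimage (continuous_apply t)).inter (hV.preimage (continuous_apply f))
  obtain ⟨𝒱, h𝒱, hc, hs⟩ := h {O | IsOpen O ∧ ∀ x y, g x ∈ O → g y ∈ O → x = y}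
    (fun O hO => hO.1) (Set.eq_univ_of_forall fun p => by
      rcases le_or_gt (p f) (neg (p t)) with hp | hp
      · refine ⟨_, ⟨hbox _ _ (isOpen_Iic (p t)) (isOpen_Iic (p f)), ?_⟩, le_rfl, le_rfl⟩
        have key : ∀ x, x ≤ p t → neg x ≤ p f → x = p t := fun x hx hx' =>
          hx.antisymm (hneg.le_iff_ge.1 (hx'.trans hp))
        exact fun x y hx hy => (key x hx.1 hx.2).trans (key y hy.1 hy.2).symm
      · have hp' : neg (p f) < p t := by simpa [hinv (p t)] using hneg hp
        by_cases hmid : ∃ c, neg (p f) < c ∧ c < p t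
        · obtain ⟨c, hc₁, hc₂⟩ := hmid
          refine ⟨_, ⟨hbox _ _ (isOpen_Ioi c) (isOpen_Ioi (neg c)), ?_⟩, hc₂, ?_⟩
          · exact fun x y hx _ => absurd (hneg.lt_iff_gt.1 hx.2) hx.1.not_gt
          · simpa [hinv (p f)] using hneg hc₁
        · refine ⟨_, ⟨hbox _ _ (isOpen_Ioi (neg (p f))) (isOpen_Ioi (neg (p t))), ?_⟩, hp', hp⟩
          exact fun x y hx _ => absurd ⟨x, hx.1, hneg.lt_iff_gt.1 hx.2⟩ hmid)
  choose V hV hgV using fun x => hs.ge (Set.mem_univ (g x))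
  refine lt_of_le_of_lt (mk_le_of_injective (f := fun x => (⟨V x, hV x⟩ : 𝒱)) ?_) hc
  intro x y hxy
  have hxy' : V x = V y := congrArg Subtype.val hxy
  exact (h𝒱 (hV x)).2 x y (hgV x) (hxy' ▸ hgV y)

end LeftHalfOpen

namespace LexBool

variable {K : Type u}

/-- Swapping the two values in a lexicographic power of `Bool`. -/
def complement (x : Lex (K → Bool)) : Lex (K → Bool) := toLex fun i => !(ofLex x i)

theorem complement_involutive : Function.Involutive (complement (K := K)) := fun x =>
  funext fun i => Bool.not_not (x i)

variable [LinearOrder K]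

theorem lt_def {x y : Lex (K → Bool)} :
    x < y ↔ ∃ i, (∀ j < i, ofLex x j = ofLex y j) ∧ ofLex x i < ofLex y i := Iff.rfl

theorem complement_strictAnti [WellFoundedLT K] : StrictAnti (complement (K := K)) := by
  intro x y hxy
  obtain ⟨i, hi, hlt⟩ := lt_def.1 hxy
  refine lt_def.2 ⟨i, fun j hj => congrArg not (hi j hj).symm, ?_⟩
  obtain ⟨hx, hy⟩ := Bool.lt_iff.1 hlt
  exact Bool.lt_iff.2 ⟨congrArg not hy, congrArg not hx⟩

theorem exists_small_dense [WellFoundedLT K] {κ : Cardinal.{u}} (hκ : κ.IsRegular) (hK : #K < κ)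
    (hpow : ∀ i : K, 2 ^ #(Set.Iio i) < κ) :
    ∃ D : Set (Lex (K → Bool)), #D < κ ∧ ∀ x y, x < y → ∃ d ∈ D, x < d ∧ d ≤ y := by
  classical
  let F : (Σ i : K, Set (Set.Iio i)) → Lex (K → Bool) := fun p =>
    toLex fun j => if h : j < p.1 then decide (⟨j, h⟩ ∈ p.2) else decide (j = p.1)
  refine ⟨Set.range F, mk_range_le.trans_lt ?_, fun x y hxy => ?_⟩
  · rw [mk_sigma]
    exact sum_lt_of_isRegular hκ hK fun i => by simpa using hpow i
  · obtain ⟨i, hi, hlt⟩ := lt_def.1 hxy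
    obtain ⟨hx, hy⟩ := Bool.lt_iff.1 hlt
    set d := F ⟨i, {j | ofLex y j.1 = true}⟩ with hd
    have hdj : ∀ j < i, ofLex d j = ofLex y j := fun j hj => by simp [hd, F, hj]
    have hdi : ofLex d i = true := by simp [hd, F]
    refine ⟨d, ⟨_, rfl⟩, lt_def.2 ⟨i, fun j hj => (hi j hj).trans (hdj j hj).symm, ?_⟩, ?_⟩
    · rw [hx, hdi]
      decide
    · refine le_of_not_gt fun hyd => ?_
      obtain ⟨k, hk, hlt⟩ := lt_def.1 hyd
      obtain ⟨hyk, hdk⟩ := Bool.lt_iff.1 hlt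
      rcases lt_trichotomy k i with h | rfl | h
      · simp [hdj k h, hyk] at hdk
      · simp [hy] at hyk
      · simp [hd, F, h.not_gt, h.ne'] at hdk

end LexBool

theorem isStrongPrelimit_of_kappaCompactSpace_pi {κ : Cardinal.{u}} (hκ : κ.IsRegular)
    (hcard : κ ^< κ = κ)
    (H : ∀ (L : Type u) [TopologicalSpace L], T2Space L → KappaCompactSpace κ L → WeightLE L κ →
      KappaCompactSpace κ (ULift.{u} Bool → L)) :
    κ.IsStrongPrelimit := by
  by_contra hno
  have hne : {c : Cardinal.{u} | c < κ ∧ κ ≤ 2 ^ c}.Nonempty := by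
    simpa [IsStrongPrelimit, Set.Nonempty] using hno
  obtain ⟨c, ⟨hcκ, hc⟩, hmin⟩ := WellFounded.has_min (r := (· < · : Cardinal.{u} → _ → Prop))
    wellFounded_lt _ hne
  let L := Lex (c.ord.ToType → Bool)
  have hL : #L = 2 ^ c := by
    change #(c.ord.ToType → Bool) = _
    simp
  obtain ⟨D, hD, hLD⟩ := LexBool.exists_small_dense (K := c.ord.ToType) hκ (by simpa using hcκ)
    fun i => by
      have hi : #(Set.Iio i) < c := by simpa using mk_Iio_lt i
      by_contra! h
      exact hmin _ ⟨hi.trans hcκ, h⟩ hi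
  let := leftHalfOpenTopology L
  refine (LeftHalfOpen.mk_lt_of_kappaCompactSpace_pi LexBool.complement_strictAnti
    LexBool.complement_involutive (H L LeftHalfOpen.t2Space
      (LeftHalfOpen.kappaCompactSpace hκ hD hLD) (LeftHalfOpen.weightLE hκ.aleph0_le ?_))).not_ge ?_
  · rw [hL]
    calc 2 ^ c ≤ κ ^ c := power_le_power_right ((ofNat_lt_aleph0 (n := 2)).le.trans hκ.aleph0_le)
      _ ≤ κ ^< κ := le_powerlt κ hcκ
      _ = κ := hcard
  · rw [hL]
    exact hc

theorem weaklyCompactCard_of_kappaCompactSpace_pi {κ : Cardinal.{u}} (hκ : ℵ₀ < κ)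
    (hcard : κ ^< κ = κ)
    (H : ∀ (ι : Type u) (X : ι → Type u) [∀ i, TopologicalSpace (X i)], #ι ≤ κ →
        (∀ i, T2Space (X i)) → (∀ i, KappaCompactSpace κ (X i)) →
        (∀ i, WeightLE (X i) κ) → KappaCompactSpace κ (∀ i, X i)) :
    WeaklyCompactCard κ := by
  have hreg := isRegular_of_powerlt_eq_self hκ.le hcard
  refine ⟨⟨hκ, hreg.le_cof_ord, isStrongPrelimit_of_kappaCompactSpace_pi hreg hcard ?_⟩,
    treeProperty_of_kappaCompactSpace_pi hreg fun X hX => ?_⟩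
  · intro L _ h2 hc hw
    exact H _ _ (by simpa using (ofNat_lt_aleph0 (n := 2)).le.trans hκ.le) (fun _ => h2) (fun _ => hc)
      fun _ => hw
  · let : ∀ a, TopologicalSpace (X a) := fun _ => ⊥
    have : ∀ a, DiscreteTopology (X a) := fun _ => ⟨rfl⟩
    refine H _ X (by simp) (fun _ => inferInstance) (fun a => kappaCompactSpace_of_card_lt (hX a))
      fun a => ⟨_, isTopologicalBasis_singletons _, ?_⟩
    exact (mk_range_le (f := fun x : X a => ({x} : Set (X a)))).trans' (by
      refine mk_le_mk_of_subset ?_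
      rintro _ ⟨x, rfl⟩
      exact ⟨x, rfl⟩) |>.trans (hX a).le

theorem weaklyCompact_iff_products_compact (κ : Cardinal.{u}) (hκ : ℵ₀ < κ)
    (hcard : κ ^< κ = κ) :
    (WeaklyCompactCard κ ↔
      ∀ (ι : Type u) (X : ι → Type u) [∀ i, TopologicalSpace (X i)], #ι ≤ κ →
        (∀ i, T2Space (X i)) → (∀ i, KappaCompactSpace κ (X i)) →
        (∀ i, WeightLE (X i) κ) →
        @KappaCompactSpace κ (∀ i, X i) (boxTopology κ X)) ∧
    (WeaklyCompactCard κ ↔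
      ∀ (ι : Type u) (X : ι → Type u) [∀ i, TopologicalSpace (X i)], #ι ≤ κ →
        (∀ i, T2Space (X i)) → (∀ i, KappaCompactSpace κ (X i)) →
        (∀ i, WeightLE (X i) κ) →
        KappaCompactSpace κ (∀ i, X i)) := by
  refine ⟨⟨fun h ι X _ hι _ hX hw => h.kappaCompactSpace_boxTopology X hι hX hw, fun H => ?_⟩,
    ⟨fun h ι X _ hι _ hX hw => (h.kappaCompactSpace_boxTopology X hι hX hw).of_coarser
      (boxTopology_le_pi hκ.le X), fun H => weaklyCompactCard_of_kappaCompactSpace_pi hκ hcard H⟩⟩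
  exact weaklyCompactCard_of_kappaCompactSpace_pi hκ hcard fun ι X _ hι h2 hX hw =>
    (H ι X hι h2 hX hw).of_coarser (boxTopology_le_pi hκ.le X)
end

section
/- Suppose κ = κ^{<κ} > ℵ₀. Then κ is weakly compact if and only if κ is weakly square compact, i.e., for every Hausdorff (<κ)-compact space X with w(X) ≤ κ, the square X × X is (<κ)-compact. -/
universe u v

open Cardinal TopologicalSpace

namespace SquareCompactness

open Set

section Cardinals

variable {κ : Cardinal.{u}}

theorem mk_Iio_toType_lt (k : κ.ord.ToType) : #(Iio k) < κ := by
  simpa using mk_Iio_lt k (by simp)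

theorem mk_Iic_toType_lt (hκ : ℵ₀ ≤ κ) (k : κ.ord.ToType) : #(Iic k) < κ := by
  simpa using mk_Iic_lt k (by simp) (by simpa using hκ)

/-- Fewer than `κ` elements of a regular cardinal `κ` have a strict upper bound. -/
theorem exists_forall_lt_toType (hκ : κ.IsRegular) {J : Type u} (hJ : #J < κ)
    (f : J → κ.ord.ToType) : ∃ k, ∀ j, f j < k := by
  by_contra! h
  have hU : (⋃ j, Iic (f j)) = Set.univ := by
    ext k
    simpa using h k
  have hlt := (card_iUnion_lt_iff_forall_of_isRegular hκ hJ (t := fun j => Iic (f j))).2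
    fun j => mk_Iic_toType_lt hκ.aleph0_le (f j)
  rw [hU, mk_univ, mk_ord_toType] at hlt
  exact hlt.false

theorem exists_gt_toType (hκ : κ.IsRegular) (k : κ.ord.ToType) : ∃ l, k < l := by
  obtain ⟨l, hl⟩ := exists_forall_lt_toType hκ (J := PUnit)
    (by simpa using one_lt_aleph0.trans_le hκ.aleph0_le) (fun _ => k)
  exact ⟨l, hl ⟨⟩⟩

theorem lt_succ_toType (hκ : κ.IsRegular) (k : κ.ord.ToType) : k < Order.succ k := by
  obtain ⟨l, hl⟩ := exists_gt_toType hκ k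
  exact Order.lt_succ_of_not_isMax fun h => h.not_lt hl

/-- An injective `κ`-sequence eventually leaves every set of cardinality less than `κ`. -/
theorem exists_forall_ge_notMem (hκ : κ.IsRegular) {α : Type u} {y : κ.ord.ToType → α}
    (hy : Function.Injective y) {s : Set α} (hs : #s < κ) : ∃ k, ∀ l, k ≤ l → y l ∉ s := by
  have hs' : #(y ⁻¹' s) < κ := (mk_preimage_of_injective y s hy).trans_lt hs
  obtain ⟨k, hk⟩ := exists_forall_lt_toType hκ hs' Subtype.val
  exact ⟨k, fun l hl hls => (hk ⟨l, hls⟩).not_ge hl⟩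

theorem isRegular_of_powerlt_self (hκ : ℵ₀ < κ) (hcard : κ ^< κ = κ) : κ.IsRegular := by
  refine ⟨hκ.le, le_of_not_gt fun h => ?_⟩
  exact (lt_power_cof_ord hκ.le).not_ge ((le_powerlt κ h).trans_eq hcard)

/-- If every subset of size less than `κ` of a linear order has a strict upper bound, then
there is a strictly increasing `κ`-sequence. -/
theorem exists_strictMono_of_forall_bounded {S : Type u} [LinearOrder S] (hκ : 0 < κ)
    (h : ∀ A : Set S, #A < κ → ∃ s, ∀ a ∈ A, a < s) :
    ∃ f : κ.ord.ToType → S, StrictMono f := by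
  have h' : ∀ A : Set S, ∃ s, #A < κ → ∀ a ∈ A, a < s := by
    intro A
    by_cases hA : #A < κ
    · obtain ⟨s, hs⟩ := h A hA
      exact ⟨s, fun _ => hs⟩
    · obtain ⟨s, -⟩ := h ∅ (by simpa using hκ)
      exact ⟨s, fun h => absurd h hA⟩
  choose g hg using h'
  let f : κ.ord.ToType → S := wellFounded_lt.fix fun k ih => g (range fun j : Iio k => ih j j.2)
  have hf : ∀ k, f k = g (range fun j : Iio k => f j) := fun k => wellFounded_lt.fix_eq _ k
  refine ⟨f, fun j k hjk => ?_⟩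
  rw [hf k]
  exact hg _ (mk_range_le.trans_lt (mk_Iio_toType_lt k)) _ ⟨⟨j, hjk⟩, rfl⟩

/-- In a linear order without strictly increasing `κ`-sequences, every subset has a cofinal
subset of cardinality less than `κ`. -/
theorem exists_cofinal_lt {L : Type u} [LinearOrder L] (hκ : 0 < κ)
    (h : ¬ ∃ f : κ.ord.ToType → L, StrictMono f) (S : Set L) :
    ∃ A ⊆ S, #A < κ ∧ ∀ s ∈ S, ∃ a ∈ A, s ≤ a := by
  by_contra! hS
  refine h ?_
  obtain ⟨f, hf⟩ := exists_strictMono_of_forall_bounded (S := S) hκ fun A hA => by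
    obtain ⟨s, hs, hs'⟩ := hS (Subtype.val '' A) (by simp) (mk_image_le.trans_lt hA)
    exact ⟨⟨s, hs⟩, fun a ha => hs' a ⟨a, ha, rfl⟩⟩
  exact ⟨fun k => f k, fun j k hjk => hf hjk⟩

theorem mk_lowerSet_le {L : Type u} [LinearOrder L] (hκ : ℵ₀ < κ) (hcard : κ ^< κ = κ)
    (hL : #L ≤ κ) (h : ¬ ∃ f : κ.ord.ToType → L, StrictMono f) : #(LowerSet L) ≤ κ := by
  let F : (Σ k : κ.ord.ToType, (Iio k → L)) → LowerSet L := fun p => lowerClosure (range p.2)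
  have hF : Function.Surjective F := by
    intro S
    obtain ⟨A, hAS, hA, hcof⟩ := exists_cofinal_lt (aleph0_pos.trans hκ) h (S : Set L)
    obtain ⟨k, hk⟩ : ∃ k : κ.ord.ToType, #(Iio k) = #A := by
      have hlt : (#A).ord < Ordinal.type (α := κ.ord.ToType) (· < ·) := by
        simpa using ord_lt_ord.2 hA
      obtain ⟨k, hk⟩ := Ordinal.typein_surj _ hlt
      refine ⟨k, ?_⟩
      have := congrArg Ordinal.card hk
      rwa [card_ord] at this
    obtain ⟨e⟩ := Cardinal.eq.1 hk
    refine ⟨⟨k, fun i => e i⟩, ?_⟩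
    have hr : range (fun i => (e i : L)) = A := by
      ext a
      exact ⟨by rintro ⟨i, rfl⟩; exact (e i).2, fun ha => ⟨e.symm ⟨a, ha⟩, by simp⟩⟩
    change lowerClosure (range fun i => (e i : L)) = S
    rw [hr]
    ext x
    refine ⟨fun hx => ?_, fun hx => mem_lowerClosure.2 (hcof x hx)⟩
    obtain ⟨a, ha, hxa⟩ := mem_lowerClosure.1 hx
    exact S.lower hxa (hAS ha)
  refine (mk_le_of_surjective hF).trans ?_
  rw [mk_sigma]
  refine (sum_le_mk_mul_iSup _).trans ?_
  rw [mk_ord_toType]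
  refine mul_le_of_le hκ.le le_rfl (ciSup_le' fun k => ?_)
  rw [← power_def]
  exact (power_le_power_right hL).trans
    ((le_powerlt κ (mk_Iio_toType_lt k)).trans_eq hcard)

theorem exists_strictMono_of_lowerSet {L : Type u} [LinearOrder L] (hκ : κ.IsRegular)
    {f : κ.ord.ToType → LowerSet L} (hf : StrictMono f) :
    ∃ g : κ.ord.ToType → L, StrictMono g := by
  have h : ∀ k, ∃ x, x ∈ f (Order.succ k) ∧ x ∉ f k := fun k =>
    not_subset.1 (hf (lt_succ_toType hκ k)).not_ge
  choose g hg hg' using h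
  refine ⟨g, fun k l hkl => lt_of_not_ge fun hle => hg' l ?_⟩
  exact (f l).lower hle (hf.monotone (Order.succ_le_of_lt hkl) (hg k))

theorem exists_strictAnti_of_lowerSet {L : Type u} [LinearOrder L] (hκ : κ.IsRegular)
    {f : κ.ord.ToType → LowerSet L} (hf : StrictAnti f) :
    ∃ g : κ.ord.ToType → L, StrictAnti g := by
  have h : ∀ k, ∃ x, x ∈ f k ∧ x ∉ f (Order.succ k) := fun k =>
    not_subset.1 (hf (lt_succ_toType hκ k)).not_ge
  choose g hg hg' using h
  refine ⟨g, fun k l hkl => lt_of_not_ge fun hle => hg' k ?_⟩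
  exact (f (Order.succ k)).lower hle (hf.antitone (Order.succ_le_of_lt hkl) (hg l))

end Cardinals

section Sorgenfrey

/-- A linear order carrying the topology generated by the half-open intervals `[x, y)` and the
final segments `[x, →)`; a greatest element is isolated. -/
def Sorgenfrey (E : Type u) : Type u := E

variable {E : Type u} [LinearOrder E]

instance : LinearOrder (Sorgenfrey E) := inferInstanceAs (LinearOrder E)

instance : TopologicalSpace (Sorgenfrey E) where
  IsOpen U := ∀ x ∈ U, ¬ IsMax x → ∃ y, x < y ∧ Ico x y ⊆ U
  isOpen_univ x _ hx := by
    obtain ⟨y, hy⟩ := not_isMax_iff.1 hx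
    exact ⟨y, hy, subset_univ _⟩
  isOpen_inter U V hU hV x hx hm := by
    obtain ⟨y, hxy, hy⟩ := hU x hx.1 hm
    obtain ⟨z, hxz, hz⟩ := hV x hx.2 hm
    refine ⟨min y z, lt_min hxy hxz, fun w hw => ⟨hy ⟨hw.1, ?_⟩, hz ⟨hw.1, ?_⟩⟩⟩
    · exact hw.2.trans_le (min_le_left _ _)
    · exact hw.2.trans_le (min_le_right _ _)
  isOpen_sUnion 𝒰 h𝒰 x hx hm := by
    obtain ⟨U, hU, hxU⟩ := hx
    obtain ⟨y, hxy, hy⟩ := h𝒰 U hU x hxU hm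
    exact ⟨y, hxy, hy.trans (subset_sUnion_of_mem hU)⟩

theorem Sorgenfrey.isOpen_iff {U : Set (Sorgenfrey E)} :
    IsOpen U ↔ ∀ x ∈ U, ¬ IsMax x → ∃ y, x < y ∧ Ico x y ⊆ U := Iff.rfl

theorem Sorgenfrey.isOpen_Iio (a : Sorgenfrey E) : IsOpen (Iio a) :=
  fun _ hx _ => ⟨a, hx, fun _ hz => hz.2⟩

theorem Sorgenfrey.isOpen_Ici (a : Sorgenfrey E) : IsOpen (Ici a) := fun _ hx hm => by
  obtain ⟨y, hy⟩ := not_isMax_iff.1 hm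
  exact ⟨y, hy, fun _ hz => le_trans hx hz.1⟩

theorem Sorgenfrey.isOpen_Ico (a b : Sorgenfrey E) : IsOpen (Ico a b) :=
  (isOpen_Ici a).inter (isOpen_Iio b)

instance : T2Space (Sorgenfrey E) := by
  have key : ∀ x y : Sorgenfrey E, x < y → ∃ u v : Set (Sorgenfrey E), IsOpen u ∧ IsOpen v ∧
      x ∈ u ∧ y ∈ v ∧ Disjoint u v := fun x y hxy =>
    ⟨Iio y, Ici y, Sorgenfrey.isOpen_Iio y, Sorgenfrey.isOpen_Ici y, hxy, self_mem_Ici,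
      disjoint_left.2 fun _ hu hv => not_le_of_gt hu hv⟩
  refine ⟨fun x y hne => ?_⟩
  rcases lt_or_gt_of_ne hne with h | h
  · exact key x y h
  · obtain ⟨u, v, hu, hv, hyu, hxv, hd⟩ := key y x h
    exact ⟨v, u, hv, hu, hxv, hyu, hd.symm⟩

theorem Sorgenfrey.isTopologicalBasis : IsTopologicalBasis
    (range (fun p : Sorgenfrey E × Sorgenfrey E => Ico p.1 p.2) ∪ range Ici) := by
  refine isTopologicalBasis_of_isOpen_of_nhds ?_ fun x U hx hU => ?_
  · rintro _ (⟨p, rfl⟩ | ⟨a, rfl⟩)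
    · exact isOpen_Ico _ _
    · exact isOpen_Ici _
  · by_cases hm : IsMax x
    · refine ⟨Ici x, Or.inr ⟨x, rfl⟩, self_mem_Ici, fun z hz => ?_⟩
      rwa [← hm.eq_of_le hz]
    · obtain ⟨y, hxy, hy⟩ := isOpen_iff.1 hU x hx hm
      exact ⟨Ico x y, Or.inl ⟨(x, y), rfl⟩, left_mem_Ico.2 hxy, hy⟩

theorem Sorgenfrey.weightLE {κ : Cardinal.{u}} (hκ : ℵ₀ ≤ κ) (hE : #E ≤ κ) :
    WeightLE (Sorgenfrey E) κ := by
  have hE' : #(Sorgenfrey E) ≤ κ := hE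
  refine ⟨_, Sorgenfrey.isTopologicalBasis, (mk_union_le _ _).trans (add_le_of_le hκ ?_ ?_)⟩
  · refine mk_range_le.trans ?_
    rw [← mul_def]
    exact mul_le_of_le hκ hE' hE'
  · exact mk_range_le.trans hE'

end Sorgenfrey

theorem Sorgenfrey.kappaCompactSpace {E : Type u} [CompleteLinearOrder E] {κ : Cardinal.{u}}
    (hκ : κ.IsRegular) (h : ¬ ∃ f : κ.ord.ToType → E, StrictMono f) :
    KappaCompactSpace κ (Sorgenfrey E) := by
  intro 𝒰 hopen hcover
  have hmem : ∀ x : Sorgenfrey E, ∃ U ∈ 𝒰, x ∈ U := fun x =>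
    mem_sUnion.1 (hcover ▸ mem_univ x)
  let Good : Set (Sorgenfrey E) → Prop := fun S => ∃ 𝒱 ⊆ 𝒰, #𝒱 < κ ∧ S ⊆ ⋃₀ 𝒱
  have good_union : ∀ S T, Good S → (∃ U ∈ 𝒰, T ⊆ U) → Good (S ∪ T) := by
    rintro S T ⟨𝒱, h𝒱, hc, hS⟩ ⟨U, hU, hT⟩
    refine ⟨insert U 𝒱, insert_subset hU h𝒱, mk_insert_le.trans_lt ?_, ?_⟩
    · exact add_lt_of_lt hκ.aleph0_le hc (one_lt_aleph0.trans_le hκ.aleph0_le)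
    · rw [sUnion_insert]
      exact union_subset (hS.trans subset_union_right) (hT.trans subset_union_left)
  let G : Set (Sorgenfrey E) := {b | Good (Iio b)}
  obtain ⟨s, hlub⟩ : ∃ s : Sorgenfrey E, IsLUB G s :=
    ⟨sSup (α := E) G, isLUB_sSup (α := E) G⟩
  obtain ⟨A, hAG, hA, hcof⟩ := exists_cofinal_lt hκ.pos h G
  have hs : s ∈ G := by
    have h1 : ∀ a : A, ∃ 𝒱 ⊆ 𝒰, #𝒱 < κ ∧ Iio (α := Sorgenfrey E) a.1 ⊆ ⋃₀ 𝒱 := fun a => hAG a.2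
    choose 𝒱 h𝒱 hc hsub using h1
    refine ⟨⋃ a, 𝒱 a, iUnion_subset h𝒱,
      (card_iUnion_lt_iff_forall_of_isRegular hκ hA).2 hc, fun x hx => ?_⟩
    obtain ⟨b, hb, hxb⟩ := (lt_isLUB_iff hlub).1 hx
    obtain ⟨a, ha, hba⟩ := hcof b hb
    exact sUnion_mono (subset_iUnion 𝒱 ⟨a, ha⟩) (hsub ⟨a, ha⟩ (hxb.trans_le hba))
  obtain ⟨U, hU, hsU⟩ := hmem s
  by_cases hm : IsMax s
  · obtain ⟨𝒱, h𝒱, hc, hS⟩ := good_union _ {s} hs ⟨U, hU, singleton_subset_iff.2 hsU⟩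
    refine ⟨𝒱, h𝒱, hc, eq_univ_of_forall fun x => hS ?_⟩
    rcases lt_or_ge x s with hx | hx
    · exact Or.inl hx
    · exact Or.inr (hm.eq_of_le hx).symm
  · exfalso
    obtain ⟨y, hy, hyU⟩ := Sorgenfrey.isOpen_iff.1 (hopen U hU) _ hsU hm
    have hyG : y ∈ G := by
      obtain ⟨𝒱, h𝒱, hc, hS⟩ := good_union _ (Ico s y) hs ⟨U, hU, hyU⟩
      refine ⟨𝒱, h𝒱, hc, fun x hx => hS ?_⟩
      rcases lt_or_ge x s with hxs | hxs
      · exact Or.inl hxs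
      · exact Or.inr ⟨hxs, hx⟩
    exact (hlub.1 hyG).not_gt hy

theorem KappaCompactSpace.sum {κ : Cardinal.{u}} (hκ : ℵ₀ ≤ κ) {X Y : Type u}
    [TopologicalSpace X] [TopologicalSpace Y] (hX : KappaCompactSpace κ X)
    (hY : KappaCompactSpace κ Y) : KappaCompactSpace κ (X ⊕ Y) := by
  have key : ∀ {Z : Type u} [TopologicalSpace Z], KappaCompactSpace κ Z → ∀ f : Z → X ⊕ Y,
      Continuous f → ∀ 𝒰 : Set (Set (X ⊕ Y)), (∀ U ∈ 𝒰, IsOpen U) → ⋃₀ 𝒰 = Set.univ →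
      ∃ 𝒱 ⊆ 𝒰, #𝒱 < κ ∧ range f ⊆ ⋃₀ 𝒱 := by
    intro Z _ hZ f hf 𝒰 ho hc
    obtain ⟨𝒲, h𝒲, hlt, hcov⟩ := hZ ((f ⁻¹' ·) '' 𝒰)
      (by rintro _ ⟨U, hU, rfl⟩; exact (ho U hU).preimage hf)
      (by rw [sUnion_image, ← preimage_iUnion₂, ← sUnion_eq_biUnion, hc, preimage_univ])
    have h1 : ∀ W : 𝒲, ∃ U ∈ 𝒰, f ⁻¹' U = W := fun W => h𝒲 W.2
    choose g hg hg' using h1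
    refine ⟨range g, range_subset_iff.2 hg, mk_range_le.trans_lt hlt, ?_⟩
    rintro _ ⟨z, rfl⟩
    obtain ⟨W, hW, hzW⟩ := mem_sUnion.1 (hcov ▸ mem_univ z)
    refine ⟨g ⟨W, hW⟩, ⟨_, rfl⟩, ?_⟩
    change z ∈ f ⁻¹' g ⟨W, hW⟩
    rwa [hg']
  intro 𝒰 ho hc
  obtain ⟨𝒱, h𝒱, hlt, hcov⟩ := key hX Sum.inl continuous_inl 𝒰 ho hc
  obtain ⟨𝒲, h𝒲, hlt', hcov'⟩ := key hY Sum.inr continuous_inr 𝒰 ho hc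
  refine ⟨𝒱 ∪ 𝒲, union_subset h𝒱 h𝒲, (mk_union_le _ _).trans_lt (add_lt_of_lt hκ hlt hlt'), ?_⟩
  rw [sUnion_union, ← univ_subset_iff, ← range_inl_union_range_inr]
  exact union_subset_union hcov hcov'

theorem WeightLE.sum {κ : Cardinal.{u}} (hκ : ℵ₀ ≤ κ) {X Y : Type u}
    [TopologicalSpace X] [TopologicalSpace Y] (hX : WeightLE X κ) (hY : WeightLE Y κ) :
    WeightLE (X ⊕ Y) κ := by
  obtain ⟨B, hB, hBκ⟩ := hX
  obtain ⟨C, hC, hCκ⟩ := hY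
  exact ⟨_, hB.sum hC, (mk_union_le _ _).trans
    (add_le_of_le hκ (mk_image_le.trans hBκ) (mk_image_le.trans hCκ))⟩

/-- The union of the two one-sided Sorgenfrey topologies on a linear order of size `κ` never has
a `(<κ)`-compact square: the diagonal copy of the order is closed and discrete in it. -/
theorem not_kappaCompactSpace_sorgenfrey_sum_square {E : Type u} [LinearOrder E]
    {κ : Cardinal.{u}} (hE : κ ≤ #E) :
    ¬ KappaCompactSpace κ
      ((Sorgenfrey E ⊕ Sorgenfrey Eᵒᵈ) × (Sorgenfrey E ⊕ Sorgenfrey Eᵒᵈ)) := by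
  intro hcomp
  let X := Sorgenfrey E ⊕ Sorgenfrey Eᵒᵈ
  let pt : E → Eᵒᵈ → X × X := fun a b =>
    (Sum.inl (a : Sorgenfrey E), Sum.inr (b : Sorgenfrey Eᵒᵈ))
  let rect : Set E → Set Eᵒᵈ → Set (X × X) := fun s t =>
    ((Sum.inl : Sorgenfrey E → X) '' s) ×ˢ ((Sum.inr : Sorgenfrey Eᵒᵈ → X) '' t)
  have rect_open : ∀ (s : Set (Sorgenfrey E)) (t : Set (Sorgenfrey Eᵒᵈ)), IsOpen s → IsOpen t →
      IsOpen (rect s t) := fun s t hs ht =>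
    (isOpenMap_inl s hs).prod (isOpenMap_inr t ht)
  have mem_rect : ∀ (s : Set E) (t : Set Eᵒᵈ) (a : E) (b : Eᵒᵈ),
      pt a b ∈ rect s t ↔ a ∈ s ∧ b ∈ t := by
    intro s t a b
    constructor
    · rintro ⟨⟨a', ha, h1⟩, ⟨b', hb, h2⟩⟩
      exact ⟨Sum.inl_injective h1 ▸ ha, Sum.inr_injective h2 ▸ hb⟩
    · rintro ⟨ha, hb⟩
      exact ⟨⟨a, ha, rfl⟩, ⟨b, hb, rfl⟩⟩
  let W : E → Set (X × X) := fun d => rect (Ici d) (Ici (OrderDual.toDual d))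
  have mem_W : ∀ d a b : E, pt a (OrderDual.toDual b) ∈ W d ↔
      d ≤ a ∧ b ≤ d := fun d a b => mem_rect _ _ _ _
  let 𝒰 : Set (Set (X × X)) := {U | IsOpen U ∧
    ∀ d : E, pt d (OrderDual.toDual d) ∉ U} ∪ range W
  have h𝒰 : ∀ U ∈ 𝒰, IsOpen U := by
    rintro U (h | ⟨d, rfl⟩)
    · exact h.1
    · exact rect_open _ _ (Sorgenfrey.isOpen_Ici (E := E) d)
        (Sorgenfrey.isOpen_Ici (E := Eᵒᵈ) (OrderDual.toDual d))
  have hcov𝒰 : ⋃₀ 𝒰 = Set.univ := by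
    refine eq_univ_of_forall ?_
    have hside : ∀ S : Set (X × X), IsOpen S →
        (∀ d : E, pt d (OrderDual.toDual d) ∉ S) →
        S ⊆ ⋃₀ 𝒰 := fun S hS hd => subset_sUnion_of_mem (Or.inl ⟨hS, hd⟩)
    rintro ⟨a | a, b | b⟩
    · exact hside (Set.univ ×ˢ range Sum.inl) (isOpen_univ.prod isOpen_range_inl) (by simp)
        (by simp)
    · rcases le_or_gt (OrderDual.ofDual b : E) (a : E) with hba | hab
      · exact ⟨W a, Or.inr ⟨a, rfl⟩, (mem_W a a (OrderDual.ofDual b)).2 ⟨le_rfl, hba⟩⟩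
      · by_cases hc : ∃ c : E, a < c ∧ c < OrderDual.ofDual b
        · obtain ⟨c, hac, hcb⟩ := hc
          refine hside (rect (Iio c) (Iio (OrderDual.toDual c)))
            (rect_open _ _ (Sorgenfrey.isOpen_Iio (E := E) c)
              (Sorgenfrey.isOpen_Iio (E := Eᵒᵈ) (OrderDual.toDual c)))
            (fun d hd => ?_) ((mem_rect _ _ _ _).2 ⟨hac, hcb⟩)
          obtain ⟨h1, h2⟩ := (mem_rect _ _ _ _).1 hd
          exact lt_asymm (show d < c from h1) h2
        · refine hside (rect (Iio (OrderDual.ofDual b)) (Iio (OrderDual.toDual (a : E))))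
            (rect_open _ _ (Sorgenfrey.isOpen_Iio (E := E) _)
              (Sorgenfrey.isOpen_Iio (E := Eᵒᵈ) _))
            (fun d hd => ?_) ((mem_rect _ _ _ _).2 ⟨hab, hab⟩)
          obtain ⟨h1, h2⟩ := (mem_rect _ _ _ _).1 hd
          exact hc ⟨d, h2, h1⟩
    · exact hside (range Sum.inr ×ˢ Set.univ) (isOpen_range_inr.prod isOpen_univ) (by simp)
        (by simp)
    · exact hside (range Sum.inr ×ˢ Set.univ) (isOpen_range_inr.prod isOpen_univ) (by simp)
        (by simp)
  obtain ⟨𝒱, h𝒱, hlt, hcov⟩ := hcomp 𝒰 h𝒰 hcov𝒰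
  have hW : ∀ d, W d ∈ 𝒱 := by
    intro d
    obtain ⟨V, hV, hdV⟩ := mem_sUnion.1
      (hcov ▸ mem_univ (pt d (OrderDual.toDual d)))
    rcases h𝒱 hV with h | ⟨d', rfl⟩
    · exact absurd hdV (h.2 d)
    · rwa [le_antisymm ((mem_W _ _ _).1 hdV).2 ((mem_W _ _ _).1 hdV).1]
  refine (hE.trans (mk_le_of_injective (f := fun d => (⟨W d, hW d⟩ : 𝒱)) ?_)).not_gt hlt
  intro d d' hdd'
  have h1 : pt d (OrderDual.toDual d) ∈ W d' := by
    rw [← show W d = W d' from congrArg Subtype.val hdd', mem_W]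
    exact ⟨le_rfl, le_rfl⟩
  exact le_antisymm ((mem_W _ _ _).1 h1).2 ((mem_W _ _ _).1 h1).1

/-- If `κ` is square compact, every linear order of size `κ` contains a monotone
`κ`-sequence. -/
theorem exists_strictMono_or_strictAnti_of_squareCompact {κ : Cardinal.{u}} (hκ : ℵ₀ < κ)
    (hcard : κ ^< κ = κ) (hsq : SquareCompact κ κ) {L : Type u} [LinearOrder L] (hL : #L = κ) :
    ∃ f : κ.ord.ToType → L, StrictMono f ∨ StrictAnti f := by
  have hreg := isRegular_of_powerlt_self hκ hcard
  by_contra! h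
  have hD : #(LowerSet L) ≤ κ := mk_lowerSet_le hκ hcard hL.le fun ⟨f, hf⟩ => (h f).1 hf
  have hD' : κ ≤ #(LowerSet L) := by
    rw [← hL]
    exact mk_le_of_injective LowerSet.Iic_injective
  have hc : KappaCompactSpace κ (Sorgenfrey (LowerSet L)) :=
    Sorgenfrey.kappaCompactSpace hreg fun ⟨f, hf⟩ =>
      let ⟨g, hg⟩ := exists_strictMono_of_lowerSet hreg hf
      (h g).1 hg
  have hc' : KappaCompactSpace κ (Sorgenfrey (LowerSet L)ᵒᵈ) :=
    Sorgenfrey.kappaCompactSpace hreg fun ⟨f, hf⟩ =>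
      let ⟨g, hg⟩ := exists_strictAnti_of_lowerSet hreg (f := fun k => OrderDual.ofDual (f k))
        fun _ _ hkl => hf hkl
      (h g).2 hg
  exact not_kappaCompactSpace_sorgenfrey_sum_square hD' <|
    hsq _ inferInstance (KappaCompactSpace.sum hκ.le hc hc')
      (WeightLE.sum hκ.le (Sorgenfrey.weightLE hκ.le hD) (Sorgenfrey.weightLE hκ.le hD))

/-- If each coordinate of a `κ`-sequence of two-valued functions can only increase while the
earlier coordinates are constant, then every coordinate is eventually constant. -/
theorem exists_eventually_eq_of_lex {κ : Cardinal.{u}} (hκ : κ.IsRegular) {I : Type u}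
    [LinearOrder I] [WellFoundedLT I] (hI : ∀ i : I, #(Iio i) < κ)
    (x : κ.ord.ToType → I → Bool)
    (hx : ∀ i k l, k ≤ l → (∀ j < i, x k j = x l j) → x k i ≤ x l i) :
    ∃ b : I → Bool, ∀ i, ∃ k, ∀ l, k ≤ l → x l i = b i := by
  suffices h : ∀ i, ∃ c, ∃ k, ∀ l, k ≤ l → x l i = c from ⟨_, fun i => (h i).choose_spec⟩
  intro i
  induction i using WellFoundedLT.induction with
  | ind i ih =>
    choose b k hk using fun j : Iio i => ih j j.2
    obtain ⟨m, hm⟩ := exists_forall_lt_toType hκ (hI i) k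
    by_cases htrue : ∃ l, m ≤ l ∧ x l i = true
    · obtain ⟨l, hml, hl⟩ := htrue
      refine ⟨true, l, fun l' hl' => ?_⟩
      have hle := hx i l l' hl' fun j hj =>
        (hk ⟨j, hj⟩ l ((hm _).le.trans hml)).trans
          (hk ⟨j, hj⟩ l' ((hm _).le.trans (hml.trans hl'))).symm
      rw [hl] at hle
      exact top_le_iff.1 hle
    · push Not at htrue
      exact ⟨false, m, fun l hl => by simpa using htrue l hl⟩

/-- If `κ` is square compact, every family of `κ` many two-valued functions on a well-order with
small initial segments has a subsequence of length `κ` that is coordinatewise eventually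
constant. -/
theorem exists_eventually_eq_of_squareCompact {κ : Cardinal.{u}} (hκ : ℵ₀ < κ)
    (hcard : κ ^< κ = κ) (hsq : SquareCompact κ κ) {I : Type u} [LinearOrder I]
    [WellFoundedLT I] (hI : ∀ i : I, #(Iio i) < κ) {P : Type u} (hP : #P = κ)
    (x : P → I → Bool) (hx : Function.Injective x) :
    ∃ y : κ.ord.ToType → P, Function.Injective y ∧
      ∃ b : I → Bool, ∀ i, ∃ k, ∀ l, k ≤ l → x (y l) i = b i := by
  have hreg := isRegular_of_powerlt_self hκ hcard
  let : LinearOrder P := LinearOrder.lift' (fun p => toLex (x p)) hx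
  have hle : ∀ (p q : P) (i : I), p ≤ q → (∀ j < i, x p j = x q j) → x p i ≤ x q i := by
    intro p q i hpq hj
    by_contra hlt
    exact not_lt_of_ge (show toLex (x p) ≤ toLex (x q) from hpq)
      ⟨i, fun j hji => (hj j hji).symm, not_le.1 hlt⟩
  obtain ⟨y, hy | hy⟩ := exists_strictMono_or_strictAnti_of_squareCompact hκ hcard hsq hP
  · exact ⟨y, hy.injective, exists_eventually_eq_of_lex hreg hI (fun k => x (y k))
      fun i k l hkl hj => hle _ _ i (hy.monotone hkl) hj⟩
  · refine ⟨y, hy.injective, ?_⟩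
    have hanti : ∀ i k l, k ≤ l → (∀ j < i, (!x (y k) j) = !x (y l) j) →
        (!x (y k) i) ≤ !x (y l) i := by
      intro i k l hkl hj
      have := hle _ _ i (hy.antitone hkl) fun j hji => by simpa using (hj j hji).symm
      revert this
      cases x (y l) i <;> cases x (y k) i <;> decide
    obtain ⟨b, hb⟩ := exists_eventually_eq_of_lex hreg hI (fun k i => !x (y k) i) hanti
    refine ⟨fun i => !b i, fun i => ?_⟩
    obtain ⟨k, hk⟩ := hb i
    exact ⟨k, fun l hl => by simp [← hk l hl]⟩

theorem two_power_lt_of_squareCompact {κ : Cardinal.{u}} (hκ : ℵ₀ < κ)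
    (hcard : κ ^< κ = κ) (hsq : SquareCompact κ κ) {c : Cardinal.{u}} (hc : c < κ) :
    (2 : Cardinal.{u}) ^ c < κ := by
  have hreg := isRegular_of_powerlt_self hκ hcard
  by_contra! hle
  have hle' : κ ≤ #(c.ord.ToType → Bool) := by simpa using hle
  obtain ⟨P, hP⟩ := le_mk_iff_exists_set.1 hle'
  obtain ⟨y, hy, b, hb⟩ := exists_eventually_eq_of_squareCompact hκ hcard hsq
    (I := c.ord.ToType) (fun i => (mk_Iio_toType_lt i).trans hc) hP Subtype.val
    Subtype.val_injective
  choose k hk using hb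
  obtain ⟨m, hm⟩ := exists_forall_lt_toType hreg (by simpa using hc) k
  have hyb : ∀ l, m ≤ l → (y l : c.ord.ToType → Bool) = b := fun l hl =>
    funext fun i => hk i l ((hm i).le.trans hl)
  have hm' := lt_succ_toType hreg m
  exact hm'.ne (hy (Subtype.ext ((hyb m le_rfl).trans (hyb _ hm'.le).symm)))

theorem isInaccessible_of_squareCompact {κ : Cardinal.{u}} (hκ : ℵ₀ < κ)
    (hcard : κ ^< κ = κ) (hsq : SquareCompact κ κ) : κ.IsInaccessible :=
  ⟨hκ, (isRegular_of_powerlt_self hκ hcard).le_cof_ord,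
    fun _ h => two_power_lt_of_squareCompact hκ hcard hsq h⟩

section Trees

variable {T : Type u} [PartialOrder T]
  (h : ∀ t : T, IsWellOrder {s : T // s < t} (fun a b => (a : T) < (b : T)))

/-- The level of a predecessor of `t` is its rank among the predecessors of `t`. -/
theorem treeLevel_eq_typein {t : T} (s : {s : T // s < t}) :
    treeLevel h s = @Ordinal.typein {s : T // s < t} (fun a b => (a : T) < (b : T)) (h t) s := by
  let := h t
  let := h s
  rw [← Ordinal.type_subrel]
  refine Ordinal.type_eq.2 ⟨⟨⟨fun r => ⟨⟨r, r.2.trans s.2⟩, r.2⟩, fun r => ⟨r.1, r.2⟩,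
    fun _ => rfl, fun _ => rfl⟩, Iff.rfl⟩⟩

theorem exists_le_treeLevel_eq {t : T} {β : Ordinal.{u}} (hβ : β ≤ treeLevel h t) :
    ∃ s ≤ t, treeLevel h s = β := by
  rcases hβ.eq_or_lt with rfl | hlt
  · exact ⟨t, le_rfl, rfl⟩
  · let := h t
    obtain ⟨s, hs⟩ := Ordinal.typein_surj (fun a b : {s : T // s < t} => (a : T) < (b : T)) hlt
    exact ⟨s, s.2.le, (treeLevel_eq_typein h s).trans hs⟩

theorem le_or_le_of_le_of_le {r s t : T}
    (h : ∀ t : T, IsWellOrder {s : T // s < t} (fun a b => (a : T) < (b : T)))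
    (hr : r ≤ t) (hs : s ≤ t) : r ≤ s ∨ s ≤ r := by
  rcases hr.eq_or_lt with rfl | hr
  · exact Or.inr hs
  rcases hs.eq_or_lt with rfl | hs
  · exact Or.inl hr.le
  let := h t
  rcases trichotomous_of (fun a b : {s : T // s < t} => (a : T) < (b : T)) ⟨r, hr⟩ ⟨s, hs⟩
    with h1 | h1 | h1
  · exact Or.inl h1.le
  · exact Or.inl (congrArg Subtype.val h1).le
  · exact Or.inr h1.le

theorem mk_treeLevel_lt {κ : Cardinal.{u}} (hκ : κ.IsRegular)
    (hlev : ∀ β : Ordinal.{u}, #{t : T | treeLevel h t = β} < κ) {β : Ordinal.{u}}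
    (hβ : β < κ.ord) : #{t : T | treeLevel h t < β} < κ := by
  have hU : {t : T | treeLevel h t < β} =
      ⋃ i : β.ToType, {t | treeLevel h t = Ordinal.typein (α := β.ToType) (· < ·) i} := by
    ext t
    simp only [mem_ofPred_eq, mem_iUnion]
    refine ⟨fun ht => ?_, fun ⟨i, hi⟩ => hi ▸ Ordinal.typein_lt_self i⟩
    obtain ⟨i, hi⟩ := Ordinal.typein_surj (α := β.ToType) (· < ·) (by simpa using ht)
    exact ⟨i, hi.symm⟩
  rw [hU]
  exact (card_iUnion_lt_iff_forall_of_isRegular hκ (by simpa using lt_ord.1 hβ)).2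
    fun i => hlev _

/-- A set containing nodes of all levels below `κ.ord` has at least `κ` elements. -/
theorem le_mk_of_forall_exists_treeLevel_eq {κ : Cardinal.{u}} {B : Set T}
    (hB : ∀ β < κ.ord, ∃ t ∈ B, treeLevel h t = β) : κ ≤ #B := by
  choose g hgB hg using fun k : κ.ord.ToType => hB _ (Ordinal.typein_lt_self k)
  rw [← mk_ord_toType κ]
  refine mk_le_of_injective (f := fun k => (⟨g k, hgB k⟩ : B)) fun k l hkl => ?_
  refine Ordinal.typein_injective (α := κ.ord.ToType) (· < ·) ?_
  rw [← hg k, ← hg l, show g k = g l from congrArg Subtype.val hkl]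

theorem mk_tree_eq {κ : Cardinal.{u}} (hκ : ℵ₀ ≤ κ) (hht : ∀ t : T, treeLevel h t < κ.ord)
    (hne : ∀ β : Ordinal.{u}, β < κ.ord → ∃ t : T, treeLevel h t = β)
    (hlev : ∀ β : Ordinal.{u}, #{t : T | treeLevel h t = β} < κ) : #T = κ := by
  refine le_antisymm ?_ ?_
  · have hU : (⋃ k : κ.ord.ToType,
        {t | treeLevel h t = Ordinal.typein (α := κ.ord.ToType) (· < ·) k}) = Set.univ := by
      refine eq_univ_of_forall fun t => mem_iUnion.2 ?_
      obtain ⟨k, hk⟩ := Ordinal.typein_surj (α := κ.ord.ToType) (· < ·)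
        (by simpa using hht t)
      exact ⟨k, hk.symm⟩
    rw [← mk_univ, ← hU]
    refine (mk_iUnion_le _).trans (mul_le_of_le hκ (mk_ord_toType κ).le ?_)
    exact ciSup_le' fun k => (hlev _).le
  · rw [← mk_univ]
    exact le_mk_of_forall_exists_treeLevel_eq h fun β hβ => by simpa using hne β hβ

end Trees

theorem treeProperty_of_squareCompact {κ : Cardinal.{u}} (hκ : ℵ₀ < κ)
    (hcard : κ ^< κ = κ) (hsq : SquareCompact κ κ) : TreeProperty κ := by
  classical
  intro T _ h hht hne hlev
  have hreg := isRegular_of_powerlt_self hκ hcard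
  have hT : #T = κ := mk_tree_eq h hκ.le hht hne hlev
  obtain ⟨e⟩ : Nonempty (T ≃ κ.ord.ToType) := Cardinal.eq.1 (by rw [hT, mk_ord_toType])
  obtain ⟨y, hy, b, hb⟩ := exists_eventually_eq_of_squareCompact hκ hcard hsq
    (I := κ.ord.ToType) mk_Iio_toType_lt hT (fun t i => decide (e.symm i ≤ t)) (by
      intro s t hst
      have hiff : ∀ r, r ≤ s ↔ r ≤ t := fun r => by simpa using congrFun hst (e r)
      exact le_antisymm ((hiff s).1 le_rfl) ((hiff t).2 le_rfl))
  have hb' : ∀ s, ∃ k, ∀ l, k ≤ l → (s ≤ y l ↔ b (e s) = true) := fun s => by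
    obtain ⟨k, hk⟩ := hb (e s)
    exact ⟨k, fun l hl => by simp [← hk l hl]⟩
  choose k hk using hb'
  refine ⟨{s | b (e s) = true}, fun r hr s hs _ => ?_, le_antisymm ?_ ?_⟩
  · exact le_or_le_of_le_of_le h ((hk r _ (le_max_left (k r) (k s))).2 hr)
      ((hk s _ (le_max_right (k r) (k s))).2 hs)
  · exact (mk_set_le _).trans hT.le
  · refine le_mk_of_forall_exists_treeLevel_eq h fun β hβ => ?_
    obtain ⟨m, hm⟩ := exists_forall_lt_toType hreg (hlev β) fun s => k s
    obtain ⟨m', hm'⟩ := exists_forall_ge_notMem hreg hy (mk_treeLevel_lt h hreg hlev hβ)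
    obtain ⟨s, hs, hsβ⟩ := exists_le_treeLevel_eq h
      (not_lt.1 (hm' (max m m') (le_max_right _ _)))
    exact ⟨s, (hk s _ ((hm ⟨s, hsβ⟩).le.trans (le_max_left _ _))).1 hs, hsβ⟩

section Patterns

variable {κ : Cardinal.{u}} {V : Type u}

/-- The tree of restrictions of the functions `z k` to initial segments `{j | j < i}` with
`i ≤ k`, a restriction being extended by a default value. -/
def PatternTree [Inhabited V] (z : κ.ord.ToType → κ.ord.ToType → V) : Type u :=
  {p : κ.ord.ToType × (κ.ord.ToType → V) //
    ∃ k, p.1 ≤ k ∧ p.2 = fun j => if j < p.1 then z k j else default}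

variable [Inhabited V] {z : κ.ord.ToType → κ.ord.ToType → V}

instance : PartialOrder (PatternTree z) where
  le p q := p.1.1 ≤ q.1.1 ∧ ∀ j < p.1.1, p.1.2 j = q.1.2 j
  le_refl p := ⟨le_rfl, fun _ _ => rfl⟩
  le_trans p q r hpq hqr :=
    ⟨hpq.1.trans hqr.1, fun j hj => (hpq.2 j hj).trans (hqr.2 j (hj.trans_le hpq.1))⟩
  le_antisymm := by
    rintro ⟨⟨i, s⟩, k, hk, hs⟩ ⟨⟨i', s'⟩, k', hk', hs'⟩ h h'
    obtain rfl : i = i' := le_antisymm h.1 h'.1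
    obtain rfl : s = s' := by
      funext j
      by_cases hj : j < i
      · exact h.2 j hj
      · simp only at hs hs'
        rw [hs, hs']
        simp [hj]
    rfl

namespace PatternTree

theorem le_def {p q : PatternTree z} :
    p ≤ q ↔ p.1.1 ≤ q.1.1 ∧ ∀ j < p.1.1, p.1.2 j = q.1.2 j := Iff.rfl

/-- The restriction of `z k` to the elements below `i`. -/
noncomputable def restrict (z : κ.ord.ToType → κ.ord.ToType → V)
    {i k : κ.ord.ToType} (hik : i ≤ k) :
    PatternTree z :=
  ⟨(i, fun j => if j < i then z k j else default), k, hik, rfl⟩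

theorem eq_of_le_of_fst_eq {p q : PatternTree z} (h : p ≤ q) (h' : p.1.1 = q.1.1) : p = q :=
  le_antisymm h ⟨h'.ge, fun j hj => (h.2 j (h' ▸ hj)).symm⟩

theorem fst_lt_of_lt {p q : PatternTree z} (h : p < q) : p.1.1 < q.1.1 :=
  h.le.1.lt_of_ne fun h' => h.ne (eq_of_le_of_fst_eq h.le h')

theorem le_of_le_of_le {p q r : PatternTree z} (hp : p ≤ r) (hq : q ≤ r) (h : p.1.1 ≤ q.1.1) :
    p ≤ q :=
  ⟨h, fun j hj => (hp.2 j hj).trans (hq.2 j (hj.trans_le h)).symm⟩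

/-- The predecessors of a node are ordered like the elements below its height. -/
noncomputable def predIso (p : PatternTree z) :
    (fun a b : {q : PatternTree z // q < p} => (a : PatternTree z) < b) ≃r
      (fun a b : Iio p.1.1 => a < b) where
  toEquiv := Equiv.ofBijective (fun q => ⟨q.1.1.1, fst_lt_of_lt q.2⟩) <| by
    constructor
    · intro q r hqr
      have hqr' : q.1.1.1 = r.1.1.1 := congrArg Subtype.val hqr
      exact Subtype.ext (eq_of_le_of_fst_eq (le_of_le_of_le q.2.le r.2.le hqr'.le) hqr')
    · rintro ⟨i, hi⟩
      obtain ⟨k, hk, hp⟩ := p.2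
      have hi' : i < p.1.1 := hi
      have hle : restrict z (hi'.le.trans hk) ≤ p := by
        refine ⟨hi'.le, fun j hj => ?_⟩
        have hj' : j < i := hj
        rw [hp]
        simp [restrict, hj', hj'.trans hi']
      exact ⟨⟨_, hle.lt_of_ne fun h => hi'.ne (congrArg (fun q => q.1.1) h)⟩, rfl⟩
  map_rel_iff' := by
    intro q r
    refine ⟨fun h => ?_, fun h => fst_lt_of_lt h⟩
    have h' : q.1.1.1 < r.1.1.1 := h
    exact (le_of_le_of_le q.2.le r.2.le h'.le).lt_of_ne fun he =>
      h'.ne (congrArg (fun q => q.1.1) he)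

theorem isWellOrder (p : PatternTree z) :
    IsWellOrder {q : PatternTree z // q < p} (fun a b => (a : PatternTree z) < b) :=
  (predIso p).toRelEmbedding.isWellOrder

theorem treeLevel_eq (p : PatternTree z) :
    treeLevel isWellOrder p = Ordinal.typein (α := κ.ord.ToType) (· < ·) p.1.1 := by
  let := isWellOrder p
  exact Ordinal.type_eq.2 ⟨predIso p⟩

theorem mk_level_lt (hκ : κ.IsInaccessible) (hV : #V < κ) (β : Ordinal.{u}) :
    #{p : PatternTree z | treeLevel isWellOrder p = β} < κ := by
  rcases isEmpty_or_nonempty {p : PatternTree z | treeLevel isWellOrder p = β} with hE | ⟨p₀, hp₀⟩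
  · simpa using hκ.pos
  have hfst : ∀ p : {p : PatternTree z | treeLevel isWellOrder p = β}, p.1.1.1 = p₀.1.1 := by
    rintro ⟨p, hp⟩
    refine Ordinal.typein_injective (α := κ.ord.ToType) (· < ·) ?_
    rw [← treeLevel_eq, ← treeLevel_eq, hp₀, hp]
  refine (mk_le_of_injective (β := Iio p₀.1.1 → V)
    (f := fun p i => p.1.1.2 i) fun p q hpq => Subtype.ext ?_).trans_lt ?_
  · refine eq_of_le_of_fst_eq ⟨((hfst p).trans (hfst q).symm).le, fun j hj => ?_⟩
      ((hfst p).trans (hfst q).symm)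
    exact congrFun hpq ⟨j, hfst p ▸ hj⟩
  · rw [← power_def]
    have hm : max #V (max #(Iio p₀.1.1) ℵ₀) < κ :=
      max_lt hV (max_lt (mk_Iio_toType_lt _) hκ.aleph0_lt)
    refine lt_of_le_of_lt ?_ (hκ.isStrongPrelimit hm)
    refine (power_le_power_right (le_max_left _ (max #(Iio p₀.1.1) ℵ₀))).trans ?_
    refine (power_le_power_left (fun h0 => ?_)
      ((le_max_left _ ℵ₀).trans (le_max_right #V _))).trans (power_self_eq ?_).le
    · exact aleph0_ne_zero (le_antisymm (h0 ▸ (le_max_right _ _).trans (le_max_right _ _))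
        zero_le)
    · exact (le_max_right _ _).trans (le_max_right _ _)

end PatternTree

/-- For weakly compact `κ`, a `κ`-sequence of functions on `κ` with few values has a limit `f`:
every proper initial segment of `f` is also an initial segment of arbitrarily late members. -/
theorem exists_limit_pattern (hκ : WeaklyCompactCard κ) (hV : #V < κ)
    (z : κ.ord.ToType → κ.ord.ToType → V) :
    ∃ f : κ.ord.ToType → V, ∀ i, ∃ k, i ≤ k ∧ ∀ j < i, z k j = f j := by
  have hreg := hκ.1.isRegular
  obtain ⟨B, hB, hBκ⟩ := hκ.2 (PatternTree z) PatternTree.isWellOrder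
    (fun p => by rw [PatternTree.treeLevel_eq]; exact Ordinal.typein_lt_self _)
    (fun β hβ => by
      obtain ⟨i, hi⟩ := Ordinal.typein_surj (α := κ.ord.ToType) (· < ·) (by simpa using hβ)
      exact ⟨PatternTree.restrict z (le_refl i), (PatternTree.treeLevel_eq _).trans hi⟩)
    (PatternTree.mk_level_lt hκ.1 hV)
  have hcof : ∀ i, ∃ p ∈ B, i < p.1.1 := by
    intro i
    by_contra! hle
    refine (mk_le_of_injective (f := fun p : B => (⟨p.1.1.1, hle _ p.2⟩ : Iic i)) ?_).not_gt
      ((mk_Iic_toType_lt hreg.aleph0_le i).trans_eq hBκ.symm)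
    intro p q hpq
    have hpq' : p.1.1.1 = q.1.1.1 := congrArg Subtype.val hpq
    rcases hB.total p.2 q.2 with h | h
    · exact Subtype.ext (PatternTree.eq_of_le_of_fst_eq h hpq')
    · exact Subtype.ext (PatternTree.eq_of_le_of_fst_eq h hpq'.symm).symm
  choose g hgB hg using hcof
  refine ⟨fun j => (g j).1.2 j, fun i => ?_⟩
  obtain ⟨k, hk, hs⟩ := (g i).2
  refine ⟨k, (hg i).le.trans hk, fun j hj => ?_⟩
  have hz : (g i).1.2 j = z k j := by
    rw [hs]
    simp [hj.trans (hg i)]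
  rw [← hz]
  rcases hB.total (hgB i) (hgB j) with h | h
  · exact h.2 j (hj.trans (hg i))
  · exact (h.2 j (hg j)).symm

end Patterns

/-- For weakly compact `κ`, a cover of a product of two `(<κ)`-compact spaces by a `κ`-sequence
of open rectangles is exhausted by a proper initial segment. -/
theorem exists_rectangle_subcover {κ : Cardinal.{u}} (hκ : WeaklyCompactCard κ) {X Y : Type u}
    [TopologicalSpace X] [TopologicalSpace Y] (hX : KappaCompactSpace κ X)
    (hY : KappaCompactSpace κ Y) (U : κ.ord.ToType → Set X) (V : κ.ord.ToType → Set Y)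
    (hU : ∀ k, IsOpen (U k)) (hV : ∀ k, IsOpen (V k)) (hcov : ∀ p : X × Y, ∃ k, p ∈ U k ×ˢ V k) :
    ∃ i, ∀ p : X × Y, ∃ k < i, p ∈ U k ×ˢ V k := by
  classical
  by_contra! hnot
  choose p hp using hnot
  have hfin : #(ULift.{u} (Bool × Bool)) < κ := (lt_aleph0_of_finite _).trans hκ.1.aleph0_lt
  obtain ⟨f, hf⟩ := exists_limit_pattern hκ hfin fun k j =>
    ⟨(decide ((p k).1 ∈ U j), decide ((p k).2 ∈ V j))⟩
  have key : ∀ {Z : Type u} [TopologicalSpace Z], KappaCompactSpace κ Z →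
      ∀ (W : κ.ord.ToType → Set Z) (q : κ.ord.ToType → Z) (c : κ.ord.ToType → Bool),
      (∀ k, IsOpen (W k)) → (∀ i, ∃ k, ∀ j < i, decide (q k ∈ W j) = c j) →
      ∃ x, ∀ j, x ∈ W j → c j = true := by
    intro Z _ hZ W q c hW hc
    by_contra! hx
    obtain ⟨𝒱, h𝒱, hlt, h𝒱cov⟩ := hZ (W '' {j | c j ≠ true})
      (by rintro _ ⟨j, -, rfl⟩; exact hW j)
      (eq_univ_of_forall fun x =>
        let ⟨j, hj, hcj⟩ := hx x
        ⟨W j, ⟨j, hcj, rfl⟩, hj⟩)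
    choose g hg hgW using fun A : 𝒱 => h𝒱 A.2
    obtain ⟨i, hi⟩ := exists_forall_lt_toType hκ.1.isRegular hlt g
    obtain ⟨k, hk⟩ := hc i
    obtain ⟨A, hA, hqA⟩ := mem_sUnion.1 (h𝒱cov ▸ mem_univ (q k))
    refine hg ⟨A, hA⟩ ((hk _ (hi ⟨A, hA⟩)).symm.trans (decide_eq_true ?_))
    rwa [hgW]
  obtain ⟨x, hx⟩ := key hX U (fun k => (p k).1) (fun j => (f j).down.1) hU fun i =>
    let ⟨k, _, hk⟩ := hf i
    ⟨k, fun j hj => congrArg (fun a => a.down.1) (hk j hj)⟩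
  obtain ⟨y, hy⟩ := key hY V (fun k => (p k).2) (fun j => (f j).down.2) hV fun i =>
    let ⟨k, _, hk⟩ := hf i
    ⟨k, fun j hj => congrArg (fun a => a.down.2) (hk j hj)⟩
  obtain ⟨j, hj⟩ := hcov (x, y)
  obtain ⟨k, hjk, hk⟩ := hf (Order.succ j)
  have hlt := lt_succ_toType hκ.1.isRegular j
  have h1 := congrArg (fun a => a.down.1) (hk j hlt)
  have h2 := congrArg (fun a => a.down.2) (hk j hlt)
  simp only [hx j hj.1, hy j hj.2, decide_eq_true_eq] at h1 h2
  exact hp k j (hlt.trans_le hjk) ⟨h1, h2⟩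

theorem squareCompact_of_weaklyCompact {κ : Cardinal.{u}} (hκ : WeaklyCompactCard κ) :
    SquareCompact κ κ := by
  intro X _ _ hX ⟨B, hB, hBκ⟩ 𝒰 ho hc
  let R : Set (Set X × Set X) := {r | r.1 ∈ B ∧ r.2 ∈ B ∧ ∃ W ∈ 𝒰, r.1 ×ˢ r.2 ⊆ W}
  have hR : #R ≤ #κ.ord.ToType := by
    refine (mk_le_of_injective (β := B × B) (f := fun r => (⟨r.1.1, r.2.1⟩, ⟨r.1.2, r.2.2.1⟩))
      fun r s hrs => ?_).trans ?_
    · simp only [Prod.mk.injEq, Subtype.mk.injEq] at hrs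
      exact Subtype.ext (Prod.ext hrs.1 hrs.2)
    · rw [← mul_def, mk_ord_toType]
      exact mul_le_of_le hκ.1.aleph0_lt.le hBκ hBκ
  obtain ⟨e⟩ := (Cardinal.le_def _ _).1 hR
  obtain ⟨i, hi⟩ := exists_rectangle_subcover hκ hX hX
    (fun k => ⋃ r : {r : R // e r = k}, r.1.1.1) (fun k => ⋃ r : {r : R // e r = k}, r.1.1.2)
    (fun k => isOpen_iUnion fun r => hB.isOpen r.1.2.1)
    (fun k => isOpen_iUnion fun r => hB.isOpen r.1.2.2.1) (fun p => by
      obtain ⟨W, hW, hpW⟩ := mem_sUnion.1 (hc ▸ mem_univ p)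
      obtain ⟨_, ⟨u, hu, v, hv, rfl⟩, hpuv, hsub⟩ :=
        (hB.prod hB).exists_subset_of_mem_open hpW (ho W hW)
      let r : R := ⟨(u, v), hu, hv, W, hW, hsub⟩
      exact ⟨e r, mem_iUnion.2 ⟨⟨r, rfl⟩, hpuv.1⟩, mem_iUnion.2 ⟨⟨r, rfl⟩, hpuv.2⟩⟩)
  have hch : ∀ r : {r : R // e r < i}, ∃ W ∈ 𝒰, r.1.1.1 ×ˢ r.1.1.2 ⊆ W := fun r => r.1.2.2.2
  choose W hW hWsub using hch
  refine ⟨range W, range_subset_iff.2 hW, mk_range_le.trans_lt ?_, eq_univ_of_forall fun p => ?_⟩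
  · refine (mk_le_of_injective (f := fun r : {r : R // e r < i} => (⟨e r.1, r.2⟩ : Iio i))
      fun r s hrs => Subtype.ext (e.injective (congrArg Subtype.val hrs))).trans_lt
      (mk_Iio_toType_lt i)
  · obtain ⟨k, hki, hk1, hk2⟩ := hi p
    obtain ⟨⟨r, hr⟩, hr1⟩ := mem_iUnion.1 hk1
    obtain ⟨⟨s, hs⟩, hs2⟩ := mem_iUnion.1 hk2
    obtain rfl : r = s := e.injective (hr.trans hs.symm)
    exact ⟨_, ⟨⟨r, hr ▸ hki⟩, rfl⟩, hWsub ⟨r, hr ▸ hki⟩ ⟨hr1, hs2⟩⟩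


end SquareCompactness

theorem weaklyCompact_iff_weakSquareCompact (κ : Cardinal.{u}) (hκ : ℵ₀ < κ)
    (hcard : κ ^< κ = κ) :
    WeaklyCompactCard κ ↔ SquareCompact κ κ := by
  exact ⟨SquareCompactness.squareCompact_of_weaklyCompact, fun h =>
    ⟨SquareCompactness.isInaccessible_of_squareCompact hκ hcard h,
      SquareCompactness.treeProperty_of_squareCompact hκ hcard h⟩⟩
end
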